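/- Fix real numbers α>0, σ>0, c2 with 0<c2≤1 and c1 with 0≤c1≤√c2. For each n∈ℕ let S_n = { x ∈ [−1/√n, 1/√n]^n : ⟨x_sol, x⟩ = c1 and ‖x‖₂² = c2 }, assume S_n is nonempty for all large n, and set ξ_n = (1/√n)·E[ min_{x∈S_n} ‖A(x_sol − x) + σ v‖₂ ]. Then liminf_{n→∞} ξ_n ≥ sup_{γ>0, ν∈ℝ} ξ_RD(α,σ;c2,c1,γ,ν), where ξ_RD(α,σ;c2,c1,γ,ν) = √α·√(1−2c1+c2+σ²) + I22(γ,ν) − I1(γ,ν) + I21(γ,ν) − ν·c1 − γ·c2. -/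

import Mathlib

open MeasureTheory ProbabilityTheory Filter Real

/-- The error function `erf(x) = (2/√π) ∫₀ˣ e^{-t²} dt`. -/
noncomputable def erf (x : ℝ) : ℝ := (2 / Real.sqrt π) * ∫ t in (0:ℝ)..x, Real.exp (-t^2)

/-- The complementary error function. -/
noncomputable def erfc (x : ℝ) : ℝ := 1 - erf x

noncomputable def I22 (γ ν : ℝ) : ℝ :=
  (1/2) * (ν + γ) * erfc ((ν + 2*γ) / Real.sqrt 2)
    - Real.exp (-(ν + 2*γ)^2 / 2) / Real.sqrt (2*π)

noncomputable def I1 (γ ν : ℝ) : ℝ :=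
  (Real.sqrt (π/2) * (ν^2 + 1) * erf ((2*γ - ν) / Real.sqrt 2)
    + Real.sqrt (π/2) * (ν^2 + 1) * erf ((2*γ + ν) / Real.sqrt 2)
    + Real.exp (-(ν + 2*γ)^2 / 2) * (ν - 2*γ)
    - Real.exp (-(ν - 2*γ)^2 / 2) * (ν + 2*γ)) / (4 * Real.sqrt (2*π) * γ)

noncomputable def I21 (γ ν : ℝ) : ℝ :=
  -(1/2) * (ν - γ) * (erf ((ν - 2*γ) / Real.sqrt 2) + 1)
    - Real.exp (-(ν - 2*γ)^2 / 2) / Real.sqrt (2*π)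

/-- The random dual objective `ξ_RD(α,σ;c2,c1,γ,ν)`. -/
noncomputable def xiRD (α σ c2 c1 γ ν : ℝ) : ℝ :=
  Real.sqrt α * Real.sqrt (1 - 2*c1 + c2 + σ^2)
    + I22 γ ν - I1 γ ν + I21 γ ν - ν*c1 - γ*c2

/-- The standard Gaussian measure on `ι → ℝ`. -/
noncomputable abbrev gaussPi (ι : Type*) [Fintype ι] : Measure (ι → ℝ) :=
  Measure.pi fun _ => gaussianReal 0 1

lemma gaussianPDFReal_zero_one (x : ℝ) :
    gaussianPDFReal 0 1 x = (√(2 * π))⁻¹ * Real.exp (-x ^ 2 / 2) := by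
  simp [gaussianPDFReal]

lemma hasDerivAt_gaussianPDFReal_zero_one (x : ℝ) :
    HasDerivAt (gaussianPDFReal 0 1) (-x * gaussianPDFReal 0 1 x) x := by
  have h : HasDerivAt (fun x : ℝ => (√(2 * π))⁻¹ * Real.exp (-x ^ 2 / 2))
      ((√(2 * π))⁻¹ * (Real.exp (-x ^ 2 / 2) * (-(2 * x) / 2))) x := by
    have h1 : HasDerivAt (fun x : ℝ => -x ^ 2 / 2) (-(2 * x) / 2) x := by
      simpa using ((hasDerivAt_pow 2 x).neg.div_const 2)
    exact h1.exp.const_mul _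
  rw [show gaussianPDFReal 0 1 = fun x : ℝ => (√(2 * π))⁻¹ * Real.exp (-x ^ 2 / 2) from
    funext gaussianPDFReal_zero_one]
  convert h using 1
  ring

lemma integral_gaussianReal_zero_one (f : ℝ → ℝ) :
    ∫ x, f x ∂(gaussianReal 0 1) = ∫ x, gaussianPDFReal 0 1 x * f x := by
  simp [integral_gaussianReal_eq_integral_smul (one_ne_zero)]

lemma integrable_gaussianReal_zero_one_iff {f : ℝ → ℝ} :
    Integrable f (gaussianReal 0 1) ↔ Integrable fun x => gaussianPDFReal 0 1 x * f x := by
  rw [gaussianReal_of_var_ne_zero _ one_ne_zero,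
    integrable_withDensity_iff_integrable_smul' (measurable_gaussianPDF 0 1)
      (ae_of_all _ fun _ => gaussianPDF_lt_top)]
  simp [toReal_gaussianPDF]

lemma integrable_pow_gaussianReal (k : ℕ) :
    Integrable (fun x : ℝ => x ^ k) (gaussianReal 0 1) := by
  have := (memLp_id_gaussianReal (μ := 0) (v := 1) k)
  rcases Nat.eq_zero_or_pos k with rfl | hk
  · simp
  · have h := this.integrable_norm_pow (by exact_mod_cast hk.ne')
    refine (integrable_norm_iff (by fun_prop)).1 ?_
    simpa using h

lemma integrable_id_gaussianReal_std : Integrable (fun x : ℝ => x) (gaussianReal 0 1) := by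
  simpa using integrable_pow_gaussianReal 1

/-- Stein's identity in dimension one. -/
lemma gaussianReal_integral_mul_eq_deriv {g g' : ℝ → ℝ} {C : ℝ}
    (hg : ∀ x, HasDerivAt g (g' x) x) (hg' : Continuous g')
    (hC : ∀ x, |g x| ≤ C) (hC' : ∀ x, |g' x| ≤ C) :
    ∫ x, x * g x ∂(gaussianReal 0 1) = ∫ x, g' x ∂(gaussianReal 0 1) := by
  have hcont : Continuous g := continuous_iff_continuousAt.2 fun x => (hg x).continuousAt
  have i1 : Integrable (fun x => g' x) (gaussianReal 0 1) :=
    Integrable.of_bound (by fun_prop) C (ae_of_all _ hC')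
  have i2 : Integrable (fun x => x * g x) (gaussianReal 0 1) :=
    integrable_id_gaussianReal_std.mul_bdd (by fun_prop) (ae_of_all _ hC)
  have i3 : Integrable (fun x => g x) (gaussianReal 0 1) :=
    Integrable.of_bound (by fun_prop) C (ae_of_all _ hC)
  rw [integrable_gaussianReal_zero_one_iff] at i1 i2 i3
  have key := integral_mul_deriv_eq_deriv_mul_of_integrable (u := g)
    (v := gaussianPDFReal 0 1) (u' := g') (v' := fun x => -x * gaussianPDFReal 0 1 x)
    (fun x _ => hg x) (fun x _ => hasDerivAt_gaussianPDFReal_zero_one x)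
    (by refine i2.neg.congr (ae_of_all _ fun x => ?_); simp; ring)
    (by refine i1.congr (ae_of_all _ fun x => ?_); simp; ring)
    (by refine i3.congr (ae_of_all _ fun x => ?_); simp; ring)
  rw [integral_gaussianReal_zero_one, integral_gaussianReal_zero_one]
  calc _ = -∫ x, g x * (-x * gaussianPDFReal 0 1 x) := by
        rw [← integral_neg]; congr 1; ext x; ring
    _ = _ := by rw [key, neg_neg]; congr 1; ext x; ring

lemma measurePreserving_update_gaussPi {ι : Type*} [Fintype ι] [DecidableEq ι] (k : ι) :
    MeasurePreserving (fun p : (ι → ℝ) × ℝ => Function.update p.1 k p.2)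
      ((gaussPi ι).prod (gaussianReal 0 1)) (gaussPi ι) := by
  have hm : Measurable (fun p : (ι → ℝ) × ℝ => Function.update p.1 k p.2) := by
    refine measurable_pi_iff.2 fun j => ?_
    by_cases h : j = k
    · subst h; simpa using measurable_snd
    · simp only [Function.update_of_ne h]; fun_prop
  refine ⟨hm, ?_⟩
  symm
  refine Measure.pi_eq fun s hs => ?_
  rw [Measure.map_apply hm (MeasurableSet.univ_pi hs)]
  have : (fun p : (ι → ℝ) × ℝ => Function.update p.1 k p.2) ⁻¹' (Set.univ.pi s)
      = (Set.univ.pi (Function.update s k Set.univ)) ×ˢ (s k) := by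
    ext ⟨x, t⟩
    simp only [Set.mem_preimage, Set.mem_pi, Set.mem_univ, true_imp_iff, Set.mem_prod]
    constructor
    · intro h
      refine ⟨fun j => ?_, by simpa using h k⟩
      by_cases hj : j = k
      · subst hj; simp
      · simpa [Function.update_of_ne hj] using h j
    · rintro ⟨h, ht⟩ j
      by_cases hj : j = k
      · subst hj; simpa using ht
      · simpa [Function.update_of_ne hj] using h j
  rw [this, Measure.prod_prod, Measure.pi_pi, ← Finset.prod_erase_mul _ _ (Finset.mem_univ k),
    ← Finset.prod_erase_mul _ (fun i => gaussianReal 0 1 (s i)) (Finset.mem_univ k)]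
  simp only [Function.update_self, measure_univ, mul_one]
  congr 1
  refine Finset.prod_congr rfl fun j hj => ?_
  rw [Function.update_of_ne (Finset.ne_of_mem_erase hj)]

lemma measurePreserving_eval_gaussPi {ι : Type*} [Fintype ι] (k : ι) :
    MeasurePreserving (fun z : ι → ℝ => z k) (gaussPi ι) (gaussianReal 0 1) :=
  measurePreserving_eval _ k

lemma integrable_eval_gaussPi {ι : Type*} [Fintype ι] (k : ι) :
    Integrable (fun z : ι → ℝ => z k) (gaussPi ι) :=
  (measurePreserving_eval_gaussPi k).integrable_comp_of_integrable integrable_id_gaussianReal_std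

lemma integral_eval_gaussPi {ι : Type*} [Fintype ι] (k : ι) :
    ∫ z, z k ∂(gaussPi ι) = 0 := by
  have := (measurePreserving_eval_gaussPi k).map_eq
  have h := integral_map (μ := gaussPi ι) (φ := fun z : ι → ℝ => z k)
    (measurable_pi_apply k).aemeasurable
    (f := fun x : ℝ => x) (by fun_prop)
  rw [this, integral_id_gaussianReal] at h
  exact h.symm

/-- Gaussian integration by parts along a coordinate. -/
lemma gaussPi_integral_mul_eq_deriv {ι : Type*} [Fintype ι] [DecidableEq ι] (k : ι)
    {F F' : (ι → ℝ) → ℝ} {C : ℝ}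
    (hF : ∀ z, HasDerivAt (fun s => F (Function.update z k s)) (F' z) (z k))
    (hFc : Continuous F) (hF' : Continuous F')
    (hC : ∀ z, |F z| ≤ C) (hC' : ∀ z, |F' z| ≤ C) :
    ∫ z, z k * F z ∂(gaussPi ι) = ∫ z, F' z ∂(gaussPi ι) := by
  have hmp := measurePreserving_update_gaussPi k
  have i1 : Integrable F' (gaussPi ι) :=
    Integrable.of_bound (by fun_prop) C (ae_of_all _ hC')
  have i2 : Integrable (fun z => z k * F z) (gaussPi ι) :=
    (integrable_eval_gaussPi k).mul_bdd (by fun_prop) (ae_of_all _ hC)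
  have tr : ∀ G : (ι → ℝ) → ℝ, Integrable G (gaussPi ι) →
      ∫ z, G z ∂(gaussPi ι) =
        ∫ z, ∫ s, G (Function.update z k s) ∂(gaussianReal 0 1) ∂(gaussPi ι) := by
    intro G hG
    have h0 := integral_prod _ (hmp.integrable_comp_of_integrable hG)
    simp only [Function.comp_apply] at h0
    rw [← h0]
    have h := integral_map (μ := (gaussPi ι).prod (gaussianReal 0 1)) hmp.aemeasurable
      (f := G) (by rw [hmp.map_eq]; exact hG.aestronglyMeasurable)
    rw [hmp.map_eq] at h
    exact h
  rw [tr _ i1, tr _ i2]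
  congr 1
  ext z
  have hu : Continuous fun s : ℝ => Function.update z k s := continuous_const.update k continuous_id
  simp only [Function.update_self]
  refine gaussianReal_integral_mul_eq_deriv (g := fun s => F (Function.update z k s))
    (g' := fun s => F' (Function.update z k s)) (C := C) (fun s => ?_) (hF'.comp hu)
    (fun s => hC _) (fun s => hC' _)
  have := hF (Function.update z k s)
  simpa using this

/-- `f1` is the gradient of `f`, tested along curves that are differentiable coordinatewise. -/
def HasGradAlongCurves {N : Type*} [Fintype N] (f : (N → ℝ) → ℝ) (f1 : N → (N → ℝ) → ℝ) : Prop :=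
  ∀ (c : ℝ → N → ℝ) (c' : N → ℝ) (t : ℝ), (∀ a, HasDerivAt (fun s => c s a) (c' a) t) →
    HasDerivAt (fun s => f (c s)) (∑ a, f1 a (c t) * c' a) t

/-- Comparison of Gaussian expectations along the path `sin θ • P ζ + cos θ • Q ζ`. -/
lemma gaussPi_integral_le_of_covariance_diff {ι N : Type*} [Fintype ι] [Fintype N]
    (P Q : N → ι → ℝ) (hPQ : ∀ a b, ∑ k, P a k * Q b k = 0)
    {f : (N → ℝ) → ℝ} {f1 : N → (N → ℝ) → ℝ} {f2 : N → N → (N → ℝ) → ℝ} {C : ℝ}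
    (hf : HasGradAlongCurves f f1) (hf1 : ∀ a, HasGradAlongCurves (f1 a) (f2 a))
    (hfc : Continuous f) (hf1c : ∀ a, Continuous (f1 a)) (hf2c : ∀ a b, Continuous (f2 a b))
    (hfb : ∀ v, |f v| ≤ C * (1 + ∑ a, |v a|))
    (hf1b : ∀ a v, |f1 a v| ≤ C) (hf2b : ∀ a b v, |f2 a b v| ≤ C)
    (hpos : ∀ v, 0 ≤ ∑ a, ∑ b, (∑ k, P a k * P b k - ∑ k, Q a k * Q b k) * f2 a b v) :
    Integrable (fun z => f (fun a => ∑ k, Q a k * z k)) (gaussPi ι) ∧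
    Integrable (fun z => f (fun a => ∑ k, P a k * z k)) (gaussPi ι) ∧
    ∫ z, f (fun a => ∑ k, Q a k * z k) ∂(gaussPi ι) ≤
      ∫ z, f (fun a => ∑ k, P a k * z k) ∂(gaussPi ι) := by
  classical
  set M : ℝ → N → ι → ℝ := fun θ a k => sin θ * P a k + cos θ * Q a k with hM
  set M' : ℝ → N → ι → ℝ := fun θ a k => cos θ * P a k - sin θ * Q a k with hM'
  set V : ℝ → (ι → ℝ) → N → ℝ := fun θ z a => ∑ k, M θ a k * z k with hV
  have hVc : ∀ θ, Continuous (V θ) := fun θ => by simp only [hV]; fun_prop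
  have hVd : ∀ z a θ, HasDerivAt (fun s => V s z a) (∑ k, M' θ a k * z k) θ := by
    intro z a θ
    simp only [hV]
    refine HasDerivAt.fun_sum fun k _ => ?_
    have := ((hasDerivAt_sin θ).mul_const (P a k)).add ((hasDerivAt_cos θ).mul_const (Q a k))
    refine HasDerivAt.mul_const (this.congr_deriv ?_) _
    simp only [hM']; ring
  have hC0 : 0 ≤ C := by
    have h := hfb 0
    simp at h
    exact (abs_nonneg _).trans h
  have hcs : ∀ θ a k, |M' θ a k| ≤ |P a k| + |Q a k| := by
    intro θ a k
    refine (abs_sub _ _).trans ?_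
    rw [abs_mul, abs_mul]
    exact add_le_add (mul_le_of_le_one_left (abs_nonneg _) (abs_cos_le_one _))
      (mul_le_of_le_one_left (abs_nonneg _) (abs_sin_le_one _))
  have iabs : ∀ k, Integrable (fun z : ι → ℝ => |z k|) (gaussPi ι) :=
    fun k => (integrable_eval_gaussPi k).abs
  have iV : ∀ θ, Integrable (fun z => f (V θ z)) (gaussPi ι) := by
    intro θ
    have hb : Integrable (fun z : ι → ℝ => C * (1 + ∑ a, ∑ k, |M θ a k| * |z k|)) (gaussPi ι) := by
      refine ((integrable_const _).add ?_).const_mul _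
      exact integrable_finsetSum _ fun a _ => integrable_finsetSum _ fun k _ =>
        (iabs k).const_mul _
    refine hb.mono' (hfc.comp (hVc θ)).aestronglyMeasurable (ae_of_all _ fun z => ?_)
    refine (hfb _).trans ?_
    gcongr with a
    refine (Finset.abs_sum_le_sum_abs _ _).trans (le_of_eq ?_)
    simp [abs_mul]
  set U' : ℝ → (ι → ℝ) → ℝ := fun θ z => ∑ a, f1 a (V θ z) * ∑ k, M' θ a k * z k with hU'
  have hderiv : ∀ θ, HasDerivAt (fun s => ∫ z, f (V s z) ∂(gaussPi ι))
      (∫ z, U' θ z ∂(gaussPi ι)) θ := by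
    intro θ
    have hb : Integrable (fun z : ι → ℝ => ∑ a, C * ∑ k, (|P a k| + |Q a k|) * |z k|)
        (gaussPi ι) :=
      integrable_finsetSum _ fun a _ => (integrable_finsetSum _ fun k _ =>
        (iabs k).const_mul _).const_mul _
    refine (hasDerivAt_integral_of_dominated_loc_of_deriv_le (s := Set.univ) (F' := U')
      univ_mem (Eventually.of_forall fun s => (hfc.comp (hVc s)).aestronglyMeasurable)
      (iV θ) ?_ (ae_of_all _ fun z s _ => ?_) hb (ae_of_all _ fun z s _ => ?_)).2
    · refine Continuous.aestronglyMeasurable ?_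
      simp only [hU']
      have := fun a => (hf1c a).comp (hVc θ)
      refine continuous_finsetSum _ fun a _ => (this a).mul (by fun_prop)
    · simp only [hU', Real.norm_eq_abs]
      refine (Finset.abs_sum_le_sum_abs _ _).trans (Finset.sum_le_sum fun a _ => ?_)
      rw [abs_mul]
      refine mul_le_mul (hf1b _ _) ?_ (abs_nonneg _) hC0
      refine (Finset.abs_sum_le_sum_abs _ _).trans (Finset.sum_le_sum fun k _ => ?_)
      rw [abs_mul]
      exact mul_le_mul_of_nonneg_right (hcs _ _ _) (abs_nonneg _)
    · exact hf (fun s => V s z) _ s fun a => hVd z a s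
  have ibp : ∀ θ a k, ∫ z, z k * f1 a (V θ z) ∂(gaussPi ι) =
      ∫ z, ∑ b, f2 a b (V θ z) * M θ b k ∂(gaussPi ι) := by
    intro θ a k
    refine gaussPi_integral_mul_eq_deriv k (C := C + ∑ b, C * |M θ b k|)
      (F := fun z => f1 a (V θ z)) (F' := fun z => ∑ b, f2 a b (V θ z) * M θ b k)
      (fun z => ?_) ((hf1c a).comp (hVc θ)) ?_ (fun z => ?_) (fun z => ?_)
    · have h := hf1 a (fun s => V θ (Function.update z k s)) (fun b => M θ b k) (z k) ?_
      · simpa using h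
      · intro b
        simp only [hV]
        have : ∀ s, ∑ j, M θ b j * Function.update z k s j =
            M θ b k * s + ∑ j ∈ Finset.univ.erase k, M θ b j * z j := by
          intro s
          rw [← Finset.add_sum_erase _ _ (Finset.mem_univ k)]
          congr 1
          · simp
          · refine Finset.sum_congr rfl fun j hj => ?_
            rw [Function.update_of_ne (Finset.ne_of_mem_erase hj)]
        simp only [this]
        simpa using ((hasDerivAt_id (z k)).const_mul (M θ b k)).add_const
          (∑ j ∈ Finset.univ.erase k, M θ b j * z j)
    · exact continuous_finsetSum _ fun b _ => ((hf2c a b).comp (hVc θ)).mul continuous_const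
    · refine (hf1b _ _).trans ?_
      have : 0 ≤ ∑ b, C * |M θ b k| := by positivity
      linarith
    · have : |∑ b, f2 a b (V θ z) * M θ b k| ≤ ∑ b, C * |M θ b k| := by
        refine (Finset.abs_sum_le_sum_abs _ _).trans (Finset.sum_le_sum fun b _ => ?_)
        rw [abs_mul]
        exact mul_le_mul_of_nonneg_right (hf2b _ _ _) (abs_nonneg _)
      linarith
  have i2 : ∀ θ a b, Integrable (fun z => f2 a b (V θ z)) (gaussPi ι) := fun θ a b =>
    Integrable.of_bound ((hf2c a b).comp (hVc θ)).aestronglyMeasurable C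
      (ae_of_all _ fun z => hf2b _ _ _)
  have i1 : ∀ θ a k, Integrable (fun z => z k * f1 a (V θ z)) (gaussPi ι) := fun θ a k =>
    (integrable_eval_gaussPi k).mul_bdd (((hf1c a).comp (hVc θ)).aestronglyMeasurable)
      (ae_of_all _ fun z => hf1b _ _)
  have hval : ∀ θ, ∫ z, U' θ z ∂(gaussPi ι) = ∫ z, (sin θ * cos θ) *
      ∑ a, ∑ b, (∑ k, P a k * P b k - ∑ k, Q a k * Q b k) * f2 a b (V θ z) ∂(gaussPi ι) := by
    intro θ
    have e1 : ∫ z, U' θ z ∂(gaussPi ι) =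
        ∑ a, ∑ k, M' θ a k * ∫ z, z k * f1 a (V θ z) ∂(gaussPi ι) := by
      simp only [hU', Finset.mul_sum]
      rw [integral_finsetSum _ fun a _ => integrable_finsetSum _ fun k _ =>
        ((i1 θ a k).const_mul (M' θ a k)).congr (ae_of_all _ fun z => by ring)]
      refine Finset.sum_congr rfl fun a _ => ?_
      rw [integral_finsetSum _ fun k _ =>
        ((i1 θ a k).const_mul (M' θ a k)).congr (ae_of_all _ fun z => by ring)]
      refine Finset.sum_congr rfl fun k _ => ?_
      rw [← integral_const_mul]
      congr 1; ext z; ring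
    have e2 : ∀ a k, M' θ a k * ∫ z, z k * f1 a (V θ z) ∂(gaussPi ι) =
        ∑ b, (M' θ a k * M θ b k) * ∫ z, f2 a b (V θ z) ∂(gaussPi ι) := by
      intro a k
      rw [ibp, integral_finsetSum _ fun b _ => (i2 θ a b).mul_const _, Finset.mul_sum]
      refine Finset.sum_congr rfl fun b _ => ?_
      rw [integral_mul_const]; ring
    have e3 : ∀ a b, ∑ k, M' θ a k * M θ b k =
        sin θ * cos θ * (∑ k, P a k * P b k - ∑ k, Q a k * Q b k) := by
      intro a b
      have h1 := hPQ a b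
      have h2 := hPQ b a
      have : ∑ k, M' θ a k * M θ b k = sin θ * cos θ * ∑ k, P a k * P b k
          - sin θ * cos θ * ∑ k, Q a k * Q b k + cos θ ^ 2 * ∑ k, P a k * Q b k
          - sin θ ^ 2 * ∑ k, P b k * Q a k := by
        simp only [Finset.mul_sum, ← Finset.sum_add_distrib, ← Finset.sum_sub_distrib]
        refine Finset.sum_congr rfl fun k _ => ?_
        simp only [hM, hM']; ring
      rw [this, h1, h2]; ring
    rw [e1, integral_const_mul, integral_finsetSum _ fun a _ => integrable_finsetSum _ fun b _ =>
      (i2 θ a b).const_mul _, Finset.mul_sum]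
    refine Finset.sum_congr rfl fun a _ => ?_
    rw [integral_finsetSum _ fun b _ => (i2 θ a b).const_mul _, Finset.mul_sum]
    simp only [e2]
    rw [Finset.sum_comm]
    refine Finset.sum_congr rfl fun b _ => ?_
    rw [← Finset.sum_mul, e3, integral_const_mul]; ring
  have hmono : MonotoneOn (fun s => ∫ z, f (V s z) ∂(gaussPi ι)) (Set.Icc 0 (π / 2)) := by
    refine monotoneOn_of_deriv_nonneg (convex_Icc _ _)
      (fun θ _ => (hderiv θ).continuousAt.continuousWithinAt)
      (fun θ _ => (hderiv θ).differentiableAt.differentiableWithinAt) fun θ hθ => ?_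
    rw [interior_Icc] at hθ
    rw [(hderiv θ).deriv, hval]
    refine integral_nonneg fun z => mul_nonneg (mul_nonneg ?_ ?_) (hpos _)
    · exact sin_nonneg_of_nonneg_of_le_pi hθ.1.le (by linarith [hθ.2, pi_pos])
    · exact cos_nonneg_of_neg_pi_div_two_le_of_le (by linarith [hθ.1, pi_pos]) hθ.2.le
  have h := hmono (Set.left_mem_Icc.2 (by positivity)) (Set.right_mem_Icc.2 (by positivity))
    (by positivity : (0:ℝ) ≤ π / 2)
  have h0 := iV 0
  have h1 := iV (π / 2)
  simp only [hV, hM, sin_zero, cos_zero, sin_pi_div_two, cos_pi_div_two, zero_mul, one_mul,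
    zero_add, add_zero] at h h0 h1
  exact ⟨h0, h1, h⟩

section SoftMin

variable {T : Type*} [Fintype T]

/-- The smooth minimum `-β⁻¹ log ∑ exp (-β φ x)`. -/
noncomputable def softMin (β : ℝ) (φ : T → ℝ) : ℝ :=
  -(1 / β) * Real.log (∑ x, Real.exp (-β * φ x))

/-- The Gibbs weights, i.e. the gradient of `softMin β`. -/
noncomputable def gibbs (β : ℝ) (φ : T → ℝ) (x : T) : ℝ :=
  Real.exp (-β * φ x) / ∑ y, Real.exp (-β * φ y)

lemma sum_exp_pos [Nonempty T] (β : ℝ) (φ : T → ℝ) : 0 < ∑ y, Real.exp (-β * φ y) :=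
  Finset.sum_pos (fun _ _ => Real.exp_pos _) Finset.univ_nonempty

lemma gibbs_nonneg (β : ℝ) (φ : T → ℝ) (x : T) : 0 ≤ gibbs β φ x := by
  unfold gibbs; positivity

lemma gibbs_le_one (β : ℝ) (φ : T → ℝ) (x : T) : gibbs β φ x ≤ 1 := by
  unfold gibbs
  refine div_le_one_of_le₀ ?_ (by positivity)
  exact Finset.single_le_sum (f := fun y => Real.exp (-β * φ y))
    (fun _ _ => (Real.exp_pos _).le) (Finset.mem_univ x)

lemma softMin_le [Nonempty T] {β : ℝ} (hβ : 0 < β) (φ : T → ℝ) (x : T) :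
    softMin β φ ≤ φ x := by
  have h : -β * φ x ≤ Real.log (∑ y, Real.exp (-β * φ y)) := by
    rw [Real.le_log_iff_exp_le (sum_exp_pos β φ)]
    exact Finset.single_le_sum (f := fun y => Real.exp (-β * φ y))
      (fun _ _ => (Real.exp_pos _).le) (Finset.mem_univ x)
  unfold softMin
  have : -(1 / β) * Real.log (∑ y, Real.exp (-β * φ y)) ≤ -(1 / β) * (-β * φ x) :=
    mul_le_mul_of_nonpos_left h (by simp [hβ.le])
  refine this.trans (le_of_eq ?_)
  field_simp

lemma le_softMin [Nonempty T] {β : ℝ} (hβ : 0 < β) {φ : T → ℝ} {m : ℝ} (hm : ∀ x, m ≤ φ x) :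
    m - Real.log (Fintype.card T) / β ≤ softMin β φ := by
  have hc : (0:ℝ) < Fintype.card T := by exact_mod_cast Fintype.card_pos
  have h : Real.log (∑ y, Real.exp (-β * φ y)) ≤ Real.log (Fintype.card T) - β * m := by
    rw [Real.log_le_iff_le_exp (sum_exp_pos β φ), sub_eq_add_neg, Real.exp_add, Real.exp_log hc]
    have : ∀ y ∈ Finset.univ, Real.exp (-β * φ y) ≤ Real.exp (-(β * m)) := fun y _ => by
      refine Real.exp_le_exp.2 ?_
      nlinarith [hm y]
    simpa using Finset.sum_le_card_nsmul _ _ _ this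
  unfold softMin
  have : -(1 / β) * (Real.log (Fintype.card T) - β * m) ≤
      -(1 / β) * Real.log (∑ y, Real.exp (-β * φ y)) :=
    mul_le_mul_of_nonpos_left h (by simp [hβ.le])
  refine le_trans (le_of_eq ?_) this
  field_simp
  ring

lemma hasDerivAt_sum_exp {β : ℝ} {φ : ℝ → T → ℝ} {φ' : T → ℝ} {t : ℝ}
    (h : ∀ x, HasDerivAt (fun s => φ s x) (φ' x) t) :
    HasDerivAt (fun s => ∑ y, Real.exp (-β * φ s y))
      (∑ y, Real.exp (-β * φ t y) * (-β * φ' y)) t :=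
  HasDerivAt.fun_sum fun y _ => ((h y).const_mul (-β)).exp

lemma hasDerivAt_softMin [Nonempty T] {β : ℝ} (hβ : 0 < β) {φ : ℝ → T → ℝ} {φ' : T → ℝ} {t : ℝ}
    (h : ∀ x, HasDerivAt (fun s => φ s x) (φ' x) t) :
    HasDerivAt (fun s => softMin β (φ s)) (∑ x, gibbs β (φ t) x * φ' x) t := by
  refine (((hasDerivAt_sum_exp h).log (sum_exp_pos β (φ t)).ne').const_mul
    (-(1 / β))).congr_deriv ?_
  rw [Finset.sum_div, Finset.mul_sum]
  refine Finset.sum_congr rfl fun x _ => ?_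
  unfold gibbs
  have := (sum_exp_pos β (φ t)).ne'
  field_simp

lemma hasDerivAt_gibbs [Nonempty T] {β : ℝ} {φ : ℝ → T → ℝ} {φ' : T → ℝ} {t : ℝ}
    (h : ∀ x, HasDerivAt (fun s => φ s x) (φ' x) t) (x : T) :
    HasDerivAt (fun s => gibbs β (φ s) x)
      (-β * gibbs β (φ t) x * (φ' x - ∑ y, gibbs β (φ t) y * φ' y)) t := by
  have hS := (sum_exp_pos β (φ t)).ne'
  refine ((((h x).const_mul (-β)).exp).div (hasDerivAt_sum_exp h) hS).congr_deriv ?_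
  have e : ∑ y, gibbs β (φ t) y * φ' y =
      (∑ y, Real.exp (-β * φ t y) * φ' y) / ∑ y, Real.exp (-β * φ t y) := by
    rw [Finset.sum_div]
    exact Finset.sum_congr rfl fun y _ => by unfold gibbs; ring
  have e2 : ∑ y, Real.exp (-β * φ t y) * (-β * φ' y) =
      -β * ∑ y, Real.exp (-β * φ t y) * φ' y := by
    rw [Finset.mul_sum]
    exact Finset.sum_congr rfl fun y _ => by ring
  rw [e, e2]
  unfold gibbs
  field_simp
  ring

/-- Comparison of the expected smooth minima of a nonlinear functional `Ψ` of two Gaussian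
families, whose covariances agree inside each block. -/
lemma gaussPi_integral_softMin_le [Nonempty T] {ι κ : Type*} [Fintype ι] [Fintype κ]
    (P Q : T × κ → ι → ℝ) (hPQ : ∀ a b, ∑ k, P a k * Q b k = 0)
    {Ψ : (κ → ℝ) → ℝ} {Ψ1 : κ → (κ → ℝ) → ℝ} {Ψ2 : κ → κ → (κ → ℝ) → ℝ} {K β : ℝ} (hβ : 0 < β)
    (hΨ : HasGradAlongCurves Ψ Ψ1) (hΨ1 : ∀ s, HasGradAlongCurves (Ψ1 s) (Ψ2 s))
    (hΨc : Continuous Ψ) (hΨ1c : ∀ s, Continuous (Ψ1 s)) (hΨ2c : ∀ s r, Continuous (Ψ2 s r))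
    (hΨb : ∀ u, |Ψ u| ≤ K * (1 + ∑ s, |u s|))
    (hΨ1b : ∀ s u, |Ψ1 s u| ≤ 1) (hΨ2b : ∀ s r u, |Ψ2 s r u| ≤ K)
    (hdiag : ∀ x s r, ∑ k, P (x, s) k * P (x, r) k - ∑ k, Q (x, s) k * Q (x, r) k = 0)
    (hoff : ∀ x y u w, 0 ≤ ∑ s, ∑ r,
      (∑ k, P (x, s) k * P (y, r) k - ∑ k, Q (x, s) k * Q (y, r) k) * (Ψ1 s u * Ψ1 r w)) :
    Integrable (fun z => softMin β (fun x => Ψ fun s => ∑ k, Q (x, s) k * z k)) (gaussPi ι) ∧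
    Integrable (fun z => softMin β (fun x => Ψ fun s => ∑ k, P (x, s) k * z k)) (gaussPi ι) ∧
    ∫ z, softMin β (fun x => Ψ fun s => ∑ k, Q (x, s) k * z k) ∂(gaussPi ι) ≤
      ∫ z, softMin β (fun x => Ψ fun s => ∑ k, P (x, s) k * z k) ∂(gaussPi ι) := by
  classical
  set φ : (T × κ → ℝ) → T → ℝ := fun v x => Ψ fun s => v (x, s) with hφ
  have hK : 0 ≤ K := by
    have h := hΨb 0
    simp at h
    exact (abs_nonneg _).trans h
  have hlog : 0 ≤ Real.log (Fintype.card T) :=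
    Real.log_nonneg (by exact_mod_cast Fintype.card_pos)
  have hφc : ∀ x, Continuous fun v => φ v x := fun x => hΨc.comp (by fun_prop)
  have hgc : ∀ x, Continuous fun v => gibbs β (φ v) x := by
    intro x
    unfold gibbs
    refine Continuous.div ?_ ?_ fun v => (sum_exp_pos β (φ v)).ne'
    · exact (continuous_const.mul (hφc x)).rexp
    · exact continuous_finsetSum _ fun y _ => (continuous_const.mul (hφc y)).rexp
  have hΨ1x : ∀ s x, Continuous fun v : T × κ → ℝ => Ψ1 s fun r => v (x, r) :=
    fun s x => (hΨ1c s).comp (by fun_prop)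
  have hφd : ∀ (c : ℝ → T × κ → ℝ) (c' : T × κ → ℝ) (t : ℝ),
      (∀ a, HasDerivAt (fun s => c s a) (c' a) t) → ∀ x,
      HasDerivAt (fun s => φ (c s) x) (∑ s, Ψ1 s (fun r => c t (x, r)) * c' (x, s)) t :=
    fun c c' t hc x => hΨ (fun τ s => c τ (x, s)) (fun s => c' (x, s)) t fun s => hc (x, s)
  refine gaussPi_integral_le_of_covariance_diff P Q hPQ
    (f := fun v => softMin β (φ v))
    (f1 := fun a v => gibbs β (φ v) a.1 * Ψ1 a.2 fun r => v (a.1, r))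
    (f2 := fun a b v => -β * gibbs β (φ v) a.1 * ((if a.1 = b.1 then 1 else 0) - gibbs β (φ v) b.1)
      * ((Ψ1 a.2 fun r => v (a.1, r)) * Ψ1 b.2 fun r => v (b.1, r))
      + if a.1 = b.1 then gibbs β (φ v) a.1 * Ψ2 a.2 b.2 fun r => v (a.1, r) else 0)
    (C := 1 + β + K + Real.log (Fintype.card T) / β) ?_ ?_ ?_ ?_ ?_ ?_ ?_ ?_ ?_
  · intro c c' t hc
    refine (hasDerivAt_softMin hβ (hφd c c' t hc)).congr_deriv ?_
    rw [Fintype.sum_prod_type]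
    refine Finset.sum_congr rfl fun x _ => ?_
    rw [Finset.mul_sum]
    exact Finset.sum_congr rfl fun s _ => by ring
  · rintro ⟨x, s⟩ c c' t hc
    have h1 := hasDerivAt_gibbs (β := β) (hφd c c' t hc) x
    have h2 := hΨ1 s (fun τ r => c τ (x, r)) (fun r => c' (x, r)) t fun r => hc (x, r)
    refine (h1.mul h2).congr_deriv ?_
    rw [Fintype.sum_prod_type]
    simp only [add_mul, Finset.sum_add_distrib, sub_mul, mul_sub]
    simp only [mul_ite, ite_mul, mul_one, mul_zero, zero_mul]
    have e1 : ∀ (g : T → κ → ℝ), ∑ y, ∑ r, (if x = y then g y r else 0) = ∑ r, g x r := by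
      intro g
      rw [Finset.sum_eq_single x]
      · simp
      · intro y _ hy; simp [Ne.symm hy]
      · simp
    simp only [Finset.sum_sub_distrib]
    rw [e1 (fun y r => _), e1 (fun y r => _)]
    simp only [Finset.mul_sum, Finset.sum_mul]
    congr 1
    · congr 1
      · exact Finset.sum_congr rfl fun r _ => by ring
      · exact Finset.sum_congr rfl fun y _ => Finset.sum_congr rfl fun r _ => by ring
    · exact Finset.sum_congr rfl fun r _ => by ring
  · unfold softMin
    refine continuous_const.mul (Continuous.log ?_ fun v => (sum_exp_pos β (φ v)).ne')
    exact continuous_finsetSum _ fun y _ => (continuous_const.mul (hφc y)).rexp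
  · exact fun a => (hgc _).mul (hΨ1x _ _)
  · rintro ⟨x, s⟩ ⟨y, r⟩
    refine Continuous.add ?_ ?_
    · exact ((continuous_const.mul (hgc _)).mul (continuous_const.sub (hgc _))).mul
        ((hΨ1x _ _).mul (hΨ1x _ _))
    · by_cases h : x = y
      · simp only [h, if_true]
        exact (hgc _).mul ((hΨ2c _ _).comp (by fun_prop))
      · simp only [h, if_false]
        exact continuous_const
  · intro v
    have hx : ∀ x, |φ v x| ≤ K * (1 + ∑ a, |v a|) := by
      intro x
      refine (hΨb _).trans ?_
      gcongr
      rw [Fintype.sum_prod_type]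
      exact Finset.single_le_sum (f := fun y => ∑ s, |v (y, s)|)
        (fun _ _ => Finset.sum_nonneg fun _ _ => abs_nonneg _) (Finset.mem_univ x)
    have hs : 0 ≤ ∑ a, |v a| := Finset.sum_nonneg fun _ _ => abs_nonneg _
    have h1 := le_softMin hβ (φ := φ v) (m := -(K * (1 + ∑ a, |v a|)))
      fun x => (abs_le.1 (hx x)).1
    have h2 := softMin_le hβ (φ v) (Classical.arbitrary T)
    have h3 := (abs_le.1 (hx (Classical.arbitrary T))).2
    have h4 : 0 ≤ Real.log (Fintype.card T) / β := by positivity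
    rw [abs_le]
    constructor <;> nlinarith [mul_nonneg h4 hs, mul_nonneg hβ.le hs]
  · rintro ⟨x, s⟩ v
    rw [abs_mul, abs_of_nonneg (gibbs_nonneg _ _ _)]
    have h4 : 0 ≤ Real.log (Fintype.card T) / β := by positivity
    have := mul_le_mul (gibbs_le_one β (φ v) x) (hΨ1b s fun r => v (x, r)) (abs_nonneg _) zero_le_one
    simp only at this ⊢
    linarith
  · rintro ⟨x, s⟩ ⟨y, r⟩ v
    have h4 : 0 ≤ Real.log (Fintype.card T) / β := by positivity
    have g0 := gibbs_nonneg β (φ v)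
    have g1 := gibbs_le_one β (φ v)
    have hd : |((if x = y then 1 else 0) - gibbs β (φ v) y : ℝ)| ≤ 1 := by
      rw [abs_le]; have := g0 y; have := g1 y
      split_ifs <;> constructor <;> linarith
    refine (abs_add_le _ _).trans ?_
    have b1 : |-β * gibbs β (φ v) x * ((if x = y then 1 else 0) - gibbs β (φ v) y)
      * ((Ψ1 s fun r => v (x, r)) * Ψ1 r fun r => v (y, r))| ≤ β := by
      rw [abs_mul, abs_mul, abs_mul, abs_mul, abs_neg, abs_of_pos hβ, abs_of_nonneg (g0 x)]
      have a1 : gibbs β (φ v) x * |((if x = y then 1 else 0) - gibbs β (φ v) y : ℝ)| ≤ 1 :=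
        mul_le_one₀ (g1 x) (abs_nonneg _) hd
      have a2 : |Ψ1 s fun r => v (x, r)| * |Ψ1 r fun r => v (y, r)| ≤ 1 :=
        mul_le_one₀ (hΨ1b _ _) (abs_nonneg _) (hΨ1b _ _)
      have a3 := mul_le_one₀ a1 (by positivity) a2
      calc _ = β * (gibbs β (φ v) x * |((if x = y then 1 else 0) - gibbs β (φ v) y : ℝ)| *
            (|Ψ1 s fun r => v (x, r)| * |Ψ1 r fun r => v (y, r)|)) := by ring
        _ ≤ β * 1 := by gcongr
        _ = β := mul_one _
    have b2 : |if x = y then gibbs β (φ v) x * Ψ2 s r fun r => v (x, r) else 0| ≤ K := by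
      split_ifs
      · rw [abs_mul, abs_of_nonneg (g0 x)]
        calc _ ≤ 1 * K := mul_le_mul (g1 x) (hΨ2b _ _ _) (abs_nonneg _) zero_le_one
          _ = K := one_mul _
      · simpa using hK
    simp only at b1 b2 ⊢
    linarith
  · intro v
    simp only [Fintype.sum_prod_type]
    have hre : ∀ x, ∑ s, ∑ y, ∑ r,
        (∑ k, P (x, s) k * P (y, r) k - ∑ k, Q (x, s) k * Q (y, r) k) *
        (-β * gibbs β (φ v) x * ((if x = y then 1 else 0) - gibbs β (φ v) y)
          * ((Ψ1 s fun r => v (x, r)) * Ψ1 r fun r => v (y, r))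
          + if x = y then gibbs β (φ v) x * Ψ2 s r fun r => v (x, r) else 0) =
        ∑ y, if x = y then 0 else β * gibbs β (φ v) x * gibbs β (φ v) y * ∑ s, ∑ r,
          (∑ k, P (x, s) k * P (y, r) k - ∑ k, Q (x, s) k * Q (y, r) k) *
            ((Ψ1 s fun r => v (x, r)) * Ψ1 r fun r => v (y, r)) := by
      intro x
      rw [Finset.sum_comm]
      refine Finset.sum_congr rfl fun y _ => ?_
      by_cases h : x = y
      · subst h
        simp [hdiag]
      · simp only [h, if_false, Finset.mul_sum]
        exact Finset.sum_congr rfl fun s _ => Finset.sum_congr rfl fun r _ => by ring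
    refine Finset.sum_nonneg fun x _ => ?_
    rw [hre]
    refine Finset.sum_nonneg fun y _ => ?_
    split_ifs
    · exact le_rfl
    · exact mul_nonneg (mul_nonneg (mul_nonneg hβ.le (gibbs_nonneg _ _ _)) (gibbs_nonneg _ _ _))
        (hoff x y _ _)

end SoftMin

lemma measurePreserving_comp_injective_gaussPi {ι κ : Type*} [Fintype ι] [Fintype κ]
    {e : κ → ι} (he : Function.Injective e) :
    MeasurePreserving (fun (z : ι → ℝ) k => z (e k)) (gaussPi ι) (gaussPi κ) := by
  have hm : Measurable (fun (z : ι → ℝ) k => z (e k)) := by fun_prop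
  refine ⟨hm, ?_⟩
  symm
  refine Measure.pi_eq fun s hs => ?_
  rw [Measure.map_apply hm (MeasurableSet.univ_pi hs)]
  have : (fun (z : ι → ℝ) k => z (e k)) ⁻¹' (Set.univ.pi s) =
      Set.univ.pi (Function.extend e s fun _ => Set.univ) := by
    ext z
    simp only [Set.mem_preimage, Set.mem_pi, Set.mem_univ, true_imp_iff]
    constructor
    · intro h i
      by_cases hi : ∃ k, e k = i
      · obtain ⟨k, rfl⟩ := hi
        simpa [he.extend_apply] using h k
      · simp [Function.extend_apply' _ _ _ hi]
    · intro h k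
      simpa [he.extend_apply] using h (e k)
  rw [this, Measure.pi_pi]
  symm
  refine Fintype.prod_of_injective e he _ _ (fun i hi => ?_) fun k => by rw [he.extend_apply]
  rw [Function.extend_apply' _ _ _ (by simpa using hi), measure_univ]

lemma MeasureTheory.MeasurePreserving.integral_comp_of_integrable {X Y : Type*}
    [MeasurableSpace X] [MeasurableSpace Y] {μ : Measure X} {ν : Measure Y} {e : X → Y}
    (he : MeasurePreserving e μ ν) {f : Y → ℝ} (hf : Integrable f ν) :
    ∫ x, f (e x) ∂μ = ∫ y, f y ∂ν := by
  have h := integral_map he.aemeasurable (f := f) (by rw [he.map_eq]; exact hf.aestronglyMeasurable)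
  rw [he.map_eq] at h
  exact h.symm

section SmoothNorm

variable {I : Type*} [Fintype I]

/-- A smooth Euclidean norm of the coordinates `some i`. -/
noncomputable def smoothNorm (δ : ℝ) (u : Option I → ℝ) : ℝ := √(δ ^ 2 + ∑ i, u (some i) ^ 2)

lemma smoothNorm_sq (δ : ℝ) (u : Option I → ℝ) :
    smoothNorm δ u ^ 2 = δ ^ 2 + ∑ i, u (some i) ^ 2 :=
  Real.sq_sqrt (by positivity)

lemma le_smoothNorm {δ : ℝ} (_ : 0 < δ) (u : Option I → ℝ) : δ ≤ smoothNorm δ u :=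
  Real.le_sqrt_of_sq_le (le_add_of_nonneg_right (by positivity))

lemma abs_le_smoothNorm (δ : ℝ) (u : Option I → ℝ) (i : I) : |u (some i)| ≤ smoothNorm δ u := by
  refine Real.le_sqrt_of_sq_le ?_
  rw [sq_abs]
  have := Finset.single_le_sum (f := fun i => u (some i) ^ 2) (fun _ _ => sq_nonneg _)
    (Finset.mem_univ i)
  nlinarith [sq_nonneg δ]

lemma sqrt_le_smoothNorm (δ : ℝ) (u : Option I → ℝ) :
    √(∑ i, u (some i) ^ 2) ≤ smoothNorm δ u :=
  Real.sqrt_le_sqrt (le_add_of_nonneg_left (sq_nonneg _))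

lemma smoothNorm_le {δ : ℝ} (hδ : 0 < δ) (u : Option I → ℝ) :
    smoothNorm δ u ≤ δ + √(∑ i, u (some i) ^ 2) := by
  have h : 0 ≤ ∑ i, u (some i) ^ 2 := by positivity
  refine Real.sqrt_le_iff.2 ⟨by positivity, ?_⟩
  nlinarith [Real.sq_sqrt h, mul_nonneg hδ.le (Real.sqrt_nonneg (∑ i, u (some i) ^ 2))]

lemma sqrt_sum_sq_le_sum_abs (a : I → ℝ) : √(∑ i, a i ^ 2) ≤ ∑ i, |a i| := by
  refine Real.sqrt_le_iff.2 ⟨by positivity, ?_⟩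
  have := Finset.sum_sq_le_sq_sum_of_nonneg (s := Finset.univ) (f := fun i => |a i|)
    fun i _ => abs_nonneg _
  simpa using this

lemma continuous_smoothNorm (δ : ℝ) : Continuous (smoothNorm δ : (Option I → ℝ) → ℝ) := by
  unfold smoothNorm; fun_prop

lemma hasDerivAt_smoothNorm {δ : ℝ} (hδ : 0 < δ) {c : ℝ → Option I → ℝ} {c' : Option I → ℝ}
    {t : ℝ} (hc : ∀ a, HasDerivAt (fun s => c s a) (c' a) t) :
    HasDerivAt (fun s => smoothNorm δ (c s))
      (∑ i, c t (some i) / smoothNorm δ (c t) * c' (some i)) t := by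
  have h0 : δ ^ 2 + ∑ i, c t (some i) ^ 2 ≠ 0 := by positivity
  have h1 : HasDerivAt (fun s => δ ^ 2 + ∑ i, c s (some i) ^ 2)
      (∑ i, 2 * c t (some i) * c' (some i)) t := by
    refine HasDerivAt.const_add _ (HasDerivAt.fun_sum fun i _ => ?_)
    simpa using (hc (some i)).fun_pow 2
  refine (h1.sqrt h0).congr_deriv ?_
  rw [Finset.sum_div]
  refine Finset.sum_congr rfl fun i _ => ?_
  change _ / (2 * smoothNorm δ (c t)) = _
  have := (hδ.trans_le (le_smoothNorm hδ (c t))).ne'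
  field_simp

/-- Gradient of `u ↦ smoothNorm δ u + u none`. -/
noncomputable def smoothNormGrad (δ : ℝ) : Option I → (Option I → ℝ) → ℝ
  | none, _ => 1
  | some i, u => u (some i) / smoothNorm δ u

open Classical in
/-- Hessian of `u ↦ smoothNorm δ u + u none`. -/
noncomputable def smoothNormHess (δ : ℝ) : Option I → Option I → (Option I → ℝ) → ℝ
  | some i, some j, u =>
      ((if i = j then 1 else 0) - u (some i) / smoothNorm δ u * (u (some j) / smoothNorm δ u))
        / smoothNorm δ u
  | _, _, _ => 0

lemma hasGradAlongCurves_smoothNorm_add {δ : ℝ} (hδ : 0 < δ) :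
    HasGradAlongCurves (fun u : Option I → ℝ => smoothNorm δ u + u none) (smoothNormGrad δ) := by
  intro c c' t hc
  refine ((hasDerivAt_smoothNorm hδ hc).add (hc none)).congr_deriv ?_
  rw [Fintype.sum_option, add_comm]
  simp [smoothNormGrad]

lemma hasGradAlongCurves_smoothNormGrad {δ : ℝ} (hδ : 0 < δ) (s : Option I) :
    HasGradAlongCurves (smoothNormGrad δ s) (smoothNormHess δ s) := by
  classical
  intro c c' t hc
  cases s with
  | none => simpa [smoothNormGrad, smoothNormHess] using hasDerivAt_const t (1:ℝ)
  | some i =>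
    have hp := (hδ.trans_le (le_smoothNorm hδ (c t))).ne'
    refine ((hc (some i)).div (hasDerivAt_smoothNorm hδ hc) hp).congr_deriv ?_
    rw [Fintype.sum_option]
    simp only [smoothNormHess, zero_mul, zero_add, sub_div, sub_mul, Finset.sum_sub_distrib]
    have : ∑ j, (if i = j then (1:ℝ) else 0) / smoothNorm δ (c t) * c' (some j) =
        c' (some i) / smoothNorm δ (c t) := by
      rw [Finset.sum_eq_single i]
      · simp; ring
      · intro j _ hj; simp [Ne.symm hj]
      · simp
    rw [this]
    have e : ∑ j, c t (some i) / smoothNorm δ (c t) * (c t (some j) / smoothNorm δ (c t)) /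
        smoothNorm δ (c t) * c' (some j) = c t (some i) / smoothNorm δ (c t) ^ 2 *
        ∑ j, c t (some j) / smoothNorm δ (c t) * c' (some j) := by
      rw [Finset.mul_sum]
      exact Finset.sum_congr rfl fun j _ => by field_simp
    rw [e]
    field_simp

lemma continuous_smoothNormGrad {δ : ℝ} (hδ : 0 < δ) (s : Option I) :
    Continuous (smoothNormGrad δ s) := by
  cases s with
  | none => exact continuous_const
  | some i =>
    exact (continuous_apply _).div (continuous_smoothNorm δ)
      fun u => (hδ.trans_le (le_smoothNorm hδ u)).ne'

lemma continuous_smoothNormHess {δ : ℝ} (hδ : 0 < δ) (s r : Option I) :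
    Continuous (smoothNormHess δ s r) := by
  classical
  cases s with
  | none => exact continuous_const
  | some i =>
    cases r with
    | none => exact continuous_const
    | some j =>
      have h1 := continuous_smoothNormGrad hδ (some i)
      have h2 := continuous_smoothNormGrad hδ (some j)
      exact (continuous_const.sub (h1.mul h2)).div (continuous_smoothNorm δ)
        fun u => (hδ.trans_le (le_smoothNorm hδ u)).ne'

lemma abs_smoothNormGrad_le {δ : ℝ} (hδ : 0 < δ) (s : Option I) (u : Option I → ℝ) :
    |smoothNormGrad δ s u| ≤ 1 := by
  cases s with
  | none => simp [smoothNormGrad]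
  | some i =>
    have h := hδ.trans_le (le_smoothNorm hδ u)
    simp only [smoothNormGrad]
    rw [abs_div, abs_of_pos h, div_le_one h]
    exact abs_le_smoothNorm δ u i

lemma abs_smoothNormHess_le {δ : ℝ} (hδ : 0 < δ) (s r : Option I) (u : Option I → ℝ) :
    |smoothNormHess δ s r u| ≤ 2 / δ := by
  classical
  have h2 : 0 ≤ 2 / δ := by positivity
  cases s with
  | none => simpa [smoothNormHess] using h2
  | some i =>
    cases r with
    | none => simpa [smoothNormHess] using h2
    | some j =>
      have h := hδ.trans_le (le_smoothNorm hδ u)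
      simp only [smoothNormHess]
      rw [abs_div, abs_of_pos h]
      refine div_le_div₀ zero_le_two ?_ hδ (le_smoothNorm hδ u)
      refine (abs_sub _ _).trans ?_
      have h1 := mul_le_one₀ (abs_smoothNormGrad_le hδ (some i) u) (abs_nonneg _)
        (abs_smoothNormGrad_le hδ (some j) u)
      rw [← abs_mul] at h1
      simp only [smoothNormGrad] at h1
      have h3 : |(if i = j then (1:ℝ) else 0)| ≤ 1 := by split_ifs <;> simp
      linarith

lemma abs_smoothNorm_add_le {δ : ℝ} (hδ : 0 < δ) (u : Option I → ℝ) :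
    |smoothNorm δ u + u none| ≤ (δ + 1 + 2 / δ) * (1 + ∑ s, |u s|) := by
  have h1 := (smoothNorm_le hδ u).trans (add_le_add_right (sqrt_sum_sq_le_sum_abs _) δ)
  have h0 := hδ.trans_le (le_smoothNorm hδ u)
  have h2 : 0 ≤ 2 / δ := by positivity
  have h3 : 0 ≤ ∑ s, |u s| := by positivity
  refine (abs_add_le _ _).trans ?_
  rw [abs_of_pos h0]
  have h4 : ∑ s, |u s| = |u none| + ∑ i, |u (some i)| := Fintype.sum_option _
  nlinarith [mul_nonneg h2 h3, mul_nonneg hδ.le h3]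

lemma sum_smoothNormGrad_mul_le_one {δ : ℝ} (hδ : 0 < δ) (u w : Option I → ℝ) :
    ∑ i, smoothNormGrad δ (some i) u * smoothNormGrad δ (some i) w ≤ 1 := by
  have key : ∀ u : Option I → ℝ, ∑ i, smoothNormGrad δ (some i) u ^ 2 ≤ 1 := by
    intro u
    have h := hδ.trans_le (le_smoothNorm hδ u)
    simp only [smoothNormGrad, div_pow]
    rw [← Finset.sum_div, div_le_one (by positivity), smoothNorm_sq]
    exact le_add_of_nonneg_left (sq_nonneg _)
  have : ∑ i, smoothNormGrad δ (some i) u * smoothNormGrad δ (some i) w ≤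
      ∑ i, (smoothNormGrad δ (some i) u ^ 2 + smoothNormGrad δ (some i) w ^ 2) / 2 :=
    Finset.sum_le_sum fun i _ => by
      nlinarith [sq_nonneg (smoothNormGrad δ (some i) u - smoothNormGrad δ (some i) w)]
  rw [← Finset.sum_div, Finset.sum_add_distrib] at this
  linarith [key u, key w]

end SmoothNorm

section Gordon

variable {T I J : Type*} [Fintype I] [Fintype J]

open Classical in
/-- Coefficients of the process `(G w_x, R g₀)` over the coordinates `(G, g₀, g, h)`. -/
noncomputable def matrixCoeff (R : ℝ) (w : T → J → ℝ) :
    T × Option I → ((I × J) ⊕ Unit) ⊕ (I ⊕ J) → ℝ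
  | (x, some i), .inl (.inl p) => if p.1 = i then w x p.2 else 0
  | (_, none), .inl (.inr _) => R
  | _, _ => 0

open Classical in
/-- Coefficients of the process `(R g, ⟨h, w_x⟩)` over the coordinates `(G, g₀, g, h)`. -/
noncomputable def decoupledCoeff (R : ℝ) (w : T → J → ℝ) :
    T × Option I → ((I × J) ⊕ Unit) ⊕ (I ⊕ J) → ℝ
  | (_, some i), .inr (.inl k) => if k = i then R else 0
  | (x, none), .inr (.inr j) => w x j
  | _, _ => 0

lemma sum_matrixCoeff_mul_decoupledCoeff (R : ℝ) (w : T → J → ℝ) (a b : T × Option I) :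
    ∑ k, matrixCoeff R w a k * decoupledCoeff R w b k = 0 := by
  rcases a with ⟨x, _ | i⟩ <;> rcases b with ⟨y, _ | j⟩ <;>
    simp [matrixCoeff, decoupledCoeff]

open Classical in
lemma covariance_diff (R : ℝ) (w : T → J → ℝ) (x y : T) (s r : Option I) :
    ∑ k, matrixCoeff R w (x, s) k * matrixCoeff R w (y, r) k -
      ∑ k, decoupledCoeff R w (x, s) k * decoupledCoeff R w (y, r) k =
    if s = r then (if s = none then R ^ 2 - ∑ j, w x j * w y j else ∑ j, w x j * w y j - R ^ 2)
      else 0 := by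
  rcases s with _ | i <;> rcases r with _ | j
  · simp [matrixCoeff, decoupledCoeff]; ring
  · simp [matrixCoeff, decoupledCoeff]
  · simp [matrixCoeff, decoupledCoeff]
  · simp only [matrixCoeff, decoupledCoeff, Fintype.sum_sum_type, Fintype.sum_prod_type]
    by_cases h : i = j
    · subst h
      simp [sq]
    · simp [h, Ne.symm h]

lemma sum_matrixCoeff_none (R : ℝ) (w : T → J → ℝ) (x : T)
    (z : ((I × J) ⊕ Unit) ⊕ (I ⊕ J) → ℝ) :
    ∑ k, matrixCoeff R w (x, none) k * z k = R * z (.inl (.inr ())) := by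
  simp [matrixCoeff]

lemma sum_matrixCoeff_some (R : ℝ) (w : T → J → ℝ) (x : T) (i : I)
    (z : ((I × J) ⊕ Unit) ⊕ (I ⊕ J) → ℝ) :
    ∑ k, matrixCoeff R w (x, some i) k * z k = ∑ j, w x j * z (.inl (.inl (i, j))) := by
  classical
  simp only [matrixCoeff, Fintype.sum_sum_type, Fintype.sum_prod_type]
  simp

lemma sum_decoupledCoeff_none (R : ℝ) (w : T → J → ℝ) (x : T)
    (z : ((I × J) ⊕ Unit) ⊕ (I ⊕ J) → ℝ) :
    ∑ k, decoupledCoeff R w (x, none) k * z k = ∑ j, w x j * z (.inr (.inr j)) := by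
  simp [decoupledCoeff]

lemma sum_decoupledCoeff_some (R : ℝ) (w : T → J → ℝ) (x : T) (i : I)
    (z : ((I × J) ⊕ Unit) ⊕ (I ⊕ J) → ℝ) :
    ∑ k, decoupledCoeff R w (x, some i) k * z k = R * z (.inr (.inl i)) := by
  classical
  simp [decoupledCoeff]

/-- Comparison of smooth minima for the matrix process and the decoupled process. -/
lemma integral_softMin_decoupled_le [Fintype T] [Nonempty T] {R β δ : ℝ} (hβ : 0 < β) (hδ : 0 < δ)
    {w : T → J → ℝ} (hw : ∀ x, ∑ j, w x j ^ 2 = R ^ 2) :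
    let F : (T × Option I → ((I × J) ⊕ Unit) ⊕ (I ⊕ J) → ℝ) →
        (((I × J) ⊕ Unit) ⊕ (I ⊕ J) → ℝ) → ℝ := fun M z =>
      softMin β fun x => smoothNorm δ (fun s => ∑ k, M (x, s) k * z k) + ∑ k, M (x, none) k * z k
    Integrable (F (decoupledCoeff R w)) (gaussPi _) ∧
    Integrable (F (matrixCoeff R w)) (gaussPi _) ∧
    ∫ z, F (decoupledCoeff R w) z ∂(gaussPi _) ≤ ∫ z, F (matrixCoeff R w) z ∂(gaussPi _) := by
  classical
  refine gaussPi_integral_softMin_le (matrixCoeff R w) (decoupledCoeff R w)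
    (sum_matrixCoeff_mul_decoupledCoeff R w)
    (Ψ := fun u => smoothNorm δ u + u none) (Ψ1 := smoothNormGrad δ) (Ψ2 := smoothNormHess δ)
    (K := δ + 1 + 2 / δ) hβ
    (hasGradAlongCurves_smoothNorm_add hδ) (hasGradAlongCurves_smoothNormGrad hδ)
    ((continuous_smoothNorm δ).add (continuous_apply _)) (continuous_smoothNormGrad hδ)
    (continuous_smoothNormHess hδ) (abs_smoothNorm_add_le hδ) (abs_smoothNormGrad_le hδ)
    (fun s r u => (abs_smoothNormHess_le hδ s r u).trans (by linarith)) ?_ ?_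
  · intro x s r
    have : ∑ j, w x j * w x j = R ^ 2 := by rw [← hw x]; simp only [sq]
    rw [covariance_diff, this]
    simp
  · intro x y u v
    have hle : ∑ j, w x j * w y j ≤ R ^ 2 := by
      have : ∑ j, w x j * w y j ≤ ∑ j, (w x j ^ 2 + w y j ^ 2) / 2 :=
        Finset.sum_le_sum fun j _ => by nlinarith [sq_nonneg (w x j - w y j)]
      rw [← Finset.sum_div, Finset.sum_add_distrib, hw, hw] at this
      linarith
    simp only [covariance_diff]
    have : ∑ s, ∑ r, (if s = r then (if s = none then R ^ 2 - ∑ j, w x j * w y j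
        else ∑ j, w x j * w y j - R ^ 2) else 0) *
        (smoothNormGrad δ s u * smoothNormGrad δ r v) =
        (R ^ 2 - ∑ j, w x j * w y j) *
        (1 - ∑ i : I, smoothNormGrad δ (some i) u * smoothNormGrad δ (some i) v) := by
      simp only [ite_mul, zero_mul, Finset.sum_ite_eq, Finset.mem_univ, if_true,
        Fintype.sum_option, reduceCtorEq, if_false, ← Finset.mul_sum]
      simp only [smoothNormGrad]
      ring
    rw [this]
    exact mul_nonneg (by linarith) (by linarith [sum_smoothNormGrad_mul_le_one hδ u v])

/-- Gordon's comparison inequality, for vectors `w x` of common Euclidean norm `R`. -/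
theorem gordon_finite [Finite T] [Nonempty T] {R : ℝ} {w : T → J → ℝ}
    (hw : ∀ x, ∑ j, w x j ^ 2 = R ^ 2)
    {L : (J → ℝ) → ℝ} {U : (I × J → ℝ) → ℝ} (hLi : Integrable L (gaussPi J))
    (hUi : Integrable U (gaussPi (I × J))) (hL : ∀ h x, L h ≤ ∑ j, w x j * h j)
    (hU : ∀ G, ∃ x, √(∑ i, (∑ j, w x j * G (i, j)) ^ 2) ≤ U G) :
    ∫ g, √(∑ i, (R * g i) ^ 2) ∂(gaussPi I) + ∫ h, L h ∂(gaussPi J) ≤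
      ∫ G, U G ∂(gaussPi (I × J)) := by
  have := Fintype.ofFinite T
  set ι := ((I × J) ⊕ Unit) ⊕ (I ⊕ J) with hι
  have mG : MeasurePreserving (fun (z : ι → ℝ) p => z (.inl (.inl p))) (gaussPi ι)
      (gaussPi (I × J)) :=
    measurePreserving_comp_injective_gaussPi (Sum.inl_injective.comp Sum.inl_injective)
  have mg : MeasurePreserving (fun (z : ι → ℝ) p => z (.inr (.inl p))) (gaussPi ι) (gaussPi I) :=
    measurePreserving_comp_injective_gaussPi (Sum.inr_injective.comp Sum.inl_injective)
  have mh : MeasurePreserving (fun (z : ι → ℝ) p => z (.inr (.inr p))) (gaussPi ι) (gaussPi J) :=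
    measurePreserving_comp_injective_gaussPi (Sum.inr_injective.comp Sum.inr_injective)
  have ig : Integrable (fun g : I → ℝ => √(∑ i, (R * g i) ^ 2)) (gaussPi I) := by
    refine (integrable_finsetSum Finset.univ fun i _ =>
      ((integrable_eval_gaussPi i).const_mul R).abs).mono'
      (Continuous.aestronglyMeasurable (by fun_prop)) (ae_of_all _ fun g => ?_)
    rw [Real.norm_of_nonneg (Real.sqrt_nonneg _)]
    exact sqrt_sum_sq_le_sum_abs _
  have main : ∀ ε : ℝ, 0 < ε → ∫ g, √(∑ i, (R * g i) ^ 2) ∂(gaussPi I) + ∫ h, L h ∂(gaussPi J) ≤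
      ∫ G, U G ∂(gaussPi (I × J)) + ε := by
    intro ε hε
    obtain ⟨β, hβ, hβε⟩ : ∃ β : ℝ, 0 < β ∧ Real.log (Fintype.card T) / β ≤ ε / 2 := by
      have hlog : 0 ≤ Real.log (Fintype.card T) :=
        Real.log_nonneg (by exact_mod_cast Fintype.card_pos)
      refine ⟨(Real.log (Fintype.card T) + 1) / (ε / 2), by positivity, ?_⟩
      rw [div_le_iff₀ (by positivity)]
      field_simp
      linarith
    obtain ⟨i1, i2, h⟩ := integral_softMin_decoupled_le (I := I) hβ (half_pos hε) hw
    simp only [sum_matrixCoeff_none, sum_decoupledCoeff_none] at i1 i2 h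
    have chain : ∫ z : ι → ℝ, (√(∑ i, (R * z (.inr (.inl i))) ^ 2) +
        L (fun j => z (.inr (.inr j))) - ε / 2) ∂(gaussPi ι) ≤
        ∫ z : ι → ℝ, (ε / 2 + U (fun p => z (.inl (.inl p))) +
        R * z (.inl (.inr ()))) ∂(gaussPi ι) := by
      refine (integral_mono (((mg.integrable_comp_of_integrable ig).add
        (mh.integrable_comp_of_integrable hLi)).sub (integrable_const _)) i1
        fun z => ?_).trans (h.trans (integral_mono i2 (((integrable_const _).add
        (mG.integrable_comp_of_integrable hUi)).add
        ((integrable_eval_gaussPi _).const_mul _)) fun z => ?_))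
      · refine le_trans (sub_le_sub_left hβε _) (le_softMin hβ fun x => ?_)
        refine add_le_add ?_ (hL _ x)
        refine le_trans (le_of_eq ?_) (sqrt_le_smoothNorm (ε / 2) _)
        simp only [sum_decoupledCoeff_some]
        rfl
      · obtain ⟨x, hx⟩ := hU fun p => z (.inl (.inl p))
        refine (softMin_le hβ _ x).trans (add_le_add_left ?_ _)
        refine (smoothNorm_le (half_pos hε) _).trans (add_le_add_right ?_ _)
        simpa only [sum_matrixCoeff_some] using hx
    have e1 := mg.integral_comp_of_integrable ig
    have e2 := mh.integral_comp_of_integrable hLi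
    have e3 := mG.integral_comp_of_integrable hUi
    have j1 := mg.integrable_comp_of_integrable ig
    have j2 := mh.integrable_comp_of_integrable hLi
    have j3 := mG.integrable_comp_of_integrable hUi
    simp only [Function.comp_def] at j1 j2 j3
    rw [integral_sub (j1.fun_add j2) (integrable_const _), integral_add j1 j2, e1, e2,
      integral_add ((integrable_const _).fun_add j3) ((integrable_eval_gaussPi _).const_mul _),
      integral_add (integrable_const _) j3, integral_const_mul, integral_eval_gaussPi, e3] at chain
    simp only [integral_const, probReal_univ, smul_eq_mul, one_mul, mul_zero, add_zero]
      at chain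
    linarith
  exact le_of_forall_pos_le_add main

end Gordon

lemma integral_comp_eval_gaussPi {ι : Type*} [Fintype ι] (k : ι) {f : ℝ → ℝ}
    (hf : Integrable f (gaussianReal 0 1)) :
    ∫ z, f (z k) ∂(gaussPi ι) = ∫ x, f x ∂(gaussianReal 0 1) :=
  (measurePreserving_eval_gaussPi k).integral_comp_of_integrable hf

lemma integrable_comp_eval_gaussPi {ι : Type*} [Fintype ι] (k : ι) {f : ℝ → ℝ}
    (hf : Integrable f (gaussianReal 0 1)) :
    Integrable (fun z : ι → ℝ => f (z k)) (gaussPi ι) :=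
  (measurePreserving_eval_gaussPi k).integrable_comp_of_integrable hf

lemma integral_sq_gaussianReal : ∫ x : ℝ, x ^ 2 ∂(gaussianReal 0 1) = 1 := by
  have h := variance_fun_id_gaussianReal (μ := 0) (v := 1)
  rw [variance_eq_integral (by fun_prop)] at h
  simpa using h

lemma integral_linear_sq_gaussPi {ι : Type*} [Fintype ι] (c : ι → ℝ) :
    Integrable (fun z : ι → ℝ => (∑ k, c k * z k) ^ 2) (gaussPi ι) ∧
    ∫ z, (∑ k, c k * z k) ^ 2 ∂(gaussPi ι) = ∑ k, c k ^ 2 := by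
  have hm : ∀ k, MemLp (fun x : ℝ => c k * x) 2 (gaussianReal 0 1) := fun k =>
    (memLp_id_gaussianReal' 2 (by simp)).const_mul _
  have hm' : ∀ k, MemLp (fun z : ι → ℝ => c k * z k) 2 (gaussPi ι) := fun k =>
    (hm k).comp_measurePreserving (measurePreserving_eval_gaussPi k)
  have hs : MemLp (fun z : ι → ℝ => ∑ k, c k * z k) 2 (gaussPi ι) :=
    memLp_finsetSum _ fun k _ => hm' k
  refine ⟨hs.integrable_sq, ?_⟩
  have h := variance_sum_pi (μ := fun _ : ι => gaussianReal 0 1) (X := fun k x => c k * x) hm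
  have h0 : ∫ z, ∑ k, c k * z k ∂(gaussPi ι) = 0 := by
    rw [integral_finsetSum _ fun k _ => (integrable_eval_gaussPi k).const_mul _]
    simp [integral_const_mul, integral_eval_gaussPi]
  have e : (∑ k, fun z : ι → ℝ => c k * z k) = fun z => ∑ k, c k * z k := by
    ext z; simp
  rw [e, variance_eq_integral hs.aestronglyMeasurable.aemeasurable, h0] at h
  simp only [sub_zero] at h
  rw [h]
  refine Finset.sum_congr rfl fun k _ => ?_
  rw [variance_const_mul, variance_fun_id_gaussianReal]
  simp

/-- The mean Euclidean norm of a standard Gaussian vector in dimension `m` is `√m - O(1/√m)`. -/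
lemma sqrt_sub_le_integral_norm_gaussPi (m : ℕ) (hm : 0 < m) {R : ℝ} (hR : 0 ≤ R) :
    R * √m * (1 - Var[fun x : ℝ => x ^ 2; gaussianReal 0 1] / (2 * m)) ≤
      ∫ g, √(∑ i, (R * g i) ^ 2) ∂(gaussPi (Fin m)) := by
  set V := Var[fun x : ℝ => x ^ 2; gaussianReal 0 1] with hV
  have hm0 : (0:ℝ) < m := by exact_mod_cast hm
  have hsq : MemLp (fun x : ℝ => x ^ 2) 2 (gaussianReal 0 1) := by
    rw [memLp_two_iff_integrable_sq (by fun_prop)]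
    simpa [← pow_mul] using integrable_pow_gaussianReal 4
  have hsq' : ∀ k, MemLp (fun z : Fin m → ℝ => z k ^ 2) 2 (gaussPi (Fin m)) := fun k =>
    hsq.comp_measurePreserving (measurePreserving_eval_gaussPi k)
  have hs : MemLp (fun z : Fin m → ℝ => ∑ k, z k ^ 2) 2 (gaussPi (Fin m)) :=
    memLp_finsetSum _ fun k _ => hsq' k
  have hmean : ∫ z, ∑ k, z k ^ 2 ∂(gaussPi (Fin m)) = m := by
    rw [integral_finsetSum _ fun k _ => integrable_comp_eval_gaussPi k (integrable_pow_gaussianReal 2)]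
    simp [integral_comp_eval_gaussPi _ (integrable_pow_gaussianReal 2), integral_sq_gaussianReal]
  have hvar : ∫ z, (∑ k, z k ^ 2 - m) ^ 2 ∂(gaussPi (Fin m)) = m * V := by
    have h := variance_sum_pi (μ := fun _ : Fin m => gaussianReal 0 1) (X := fun _ x => x ^ 2)
      fun _ => hsq
    have e : (∑ k, fun z : Fin m → ℝ => z k ^ 2) = fun z => ∑ k, z k ^ 2 := by
      ext z; simp
    rw [e, variance_eq_integral hs.aestronglyMeasurable.aemeasurable, hmean] at h
    rw [h]; simp [hV]
  have i1 : Integrable (fun z : Fin m → ℝ => ∑ k, z k ^ 2) (gaussPi (Fin m)) :=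
    hs.integrable one_le_two
  have i2 : Integrable (fun z : Fin m → ℝ => (∑ k, z k ^ 2 - (m:ℝ)) ^ 2) (gaussPi (Fin m)) :=
    (hs.sub (memLp_const _)).integrable_sq
  have hpt : ∀ g : Fin m → ℝ, R * √m * (1 + (∑ k, g k ^ 2 - m) / (2 * m) -
      (∑ k, g k ^ 2 - m) ^ 2 / (2 * m ^ 2)) ≤ √(∑ i, (R * g i) ^ 2) := by
    intro g
    have e1 : ∑ i, (R * g i) ^ 2 = R ^ 2 * (m * ((∑ k, g k ^ 2) / m)) := by
      rw [mul_div_cancel₀ _ hm0.ne', Finset.mul_sum]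
      exact Finset.sum_congr rfl fun i _ => by ring
    rw [e1, Real.sqrt_mul (sq_nonneg R), Real.sqrt_sq hR, Real.sqrt_mul hm0.le, ← mul_assoc]
    refine mul_le_mul_of_nonneg_left ?_ (by positivity)
    have hu : 0 ≤ (∑ k, g k ^ 2) / m := by positivity
    have e2 : 1 + (∑ k, g k ^ 2 - m) / (2 * m) - (∑ k, g k ^ 2 - m) ^ 2 / (2 * m ^ 2) =
        1 + ((∑ k, g k ^ 2) / m - 1) / 2 - ((∑ k, g k ^ 2) / m - 1) ^ 2 / 2 := by
      field_simp
    rw [e2]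
    set u := (∑ k, g k ^ 2) / m
    have hs := Real.sq_sqrt hu
    have hs0 := Real.sqrt_nonneg u
    set s := √u
    rw [← hs]
    nlinarith [mul_nonneg (mul_nonneg (sq_nonneg (s - 1)) hs0) (by linarith : 0 ≤ s + 2)]
  have ig : Integrable (fun g : Fin m → ℝ => √(∑ i, (R * g i) ^ 2)) (gaussPi (Fin m)) := by
    refine (integrable_finsetSum Finset.univ fun i _ =>
      ((integrable_eval_gaussPi i).const_mul R).abs).mono'
      (Continuous.aestronglyMeasurable (by fun_prop)) (ae_of_all _ fun g => ?_)
    rw [Real.norm_of_nonneg (Real.sqrt_nonneg _)]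
    exact sqrt_sum_sq_le_sum_abs _
  have j1 : Integrable (fun g : Fin m → ℝ => (∑ k, g k ^ 2 - (m:ℝ)) / (2 * m)) (gaussPi (Fin m)) :=
    (i1.sub (integrable_const _)).div_const _
  have j2 := i2.div_const (2 * (m:ℝ) ^ 2)
  refine le_trans (le_of_eq ?_) (integral_mono
    ((((integrable_const (1:ℝ)).fun_add j1).sub j2).const_mul (R * √m)) ig hpt)
  rw [integral_const_mul]
  congr 1
  have e := integral_sub ((integrable_const (1:ℝ)).fun_add j1) j2
  simp only [Pi.sub_apply]
  rw [e, integral_add (integrable_const _) j1, integral_div, integral_div, hvar,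
    integral_sub i1 (integrable_const _), hmean]
  simp
  field_simp

/-- The mean norm of `G w` is at most `√m ‖w‖`. -/
lemma integral_norm_matrix_mul_le {J : Type*} [Fintype J] (m : ℕ) {R : ℝ} (hR : 0 < R)
    (hm : 0 < m) {w : J → ℝ} (hw : ∑ j, w j ^ 2 = R ^ 2) :
    Integrable (fun G : Fin m × J → ℝ => √(∑ i, (∑ j, w j * G (i, j)) ^ 2)) (gaussPi _) ∧
    ∫ G, √(∑ i, (∑ j, w j * G (i, j)) ^ 2) ∂(gaussPi (Fin m × J)) ≤ √m * R := by
  have hm0 : (0:ℝ) < m := by exact_mod_cast hm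
  have mr : ∀ i : Fin m, MeasurePreserving (fun (G : Fin m × J → ℝ) j => G (i, j))
      (gaussPi _) (gaussPi J) := fun i =>
    measurePreserving_comp_injective_gaussPi (Prod.mk_right_injective i)
  obtain ⟨l1, l2⟩ := integral_linear_sq_gaussPi w
  have i1 : ∀ i : Fin m, Integrable (fun G : Fin m × J → ℝ => (∑ j, w j * G (i, j)) ^ 2)
      (gaussPi _) := fun i => (mr i).integrable_comp_of_integrable l1
  have e1 : ∀ i : Fin m, ∫ G, (∑ j, w j * G (i, j)) ^ 2 ∂(gaussPi (Fin m × J)) = R ^ 2 :=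
    fun i => by rw [← hw, ← l2]; exact (mr i).integral_comp_of_integrable l1
  have i2 : Integrable (fun G : Fin m × J → ℝ => (∑ i, (∑ j, w j * G (i, j)) ^ 2) / (√m * R) / 2
      + √m * R / 2) (gaussPi _) :=
    (((integrable_finsetSum _ fun i _ => i1 i).div_const _).div_const _).add (integrable_const _)
  have hpt : ∀ G : Fin m × J → ℝ, √(∑ i, (∑ j, w j * G (i, j)) ^ 2) ≤
      (∑ i, (∑ j, w j * G (i, j)) ^ 2) / (√m * R) / 2 + √m * R / 2 := by
    intro G
    have ha : 0 < √m * R := by positivity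
    have h0 : 0 ≤ ∑ i, (∑ j, w j * G (i, j)) ^ 2 := by positivity
    have hs := Real.sq_sqrt h0
    set s := √(∑ i, (∑ j, w j * G (i, j)) ^ 2)
    rw [← hs]
    set a := √m * R
    have : s ^ 2 / a / 2 + a / 2 - s = (s - a) ^ 2 / (2 * a) := by field_simp; ring
    have h2 : 0 ≤ (s - a) ^ 2 / (2 * a) := by positivity
    linarith
  have i3 : Integrable (fun G : Fin m × J → ℝ => √(∑ i, (∑ j, w j * G (i, j)) ^ 2))
      (gaussPi _) :=
    i2.mono' (Continuous.aestronglyMeasurable (by fun_prop)) (ae_of_all _ fun G => by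
      rw [Real.norm_of_nonneg (Real.sqrt_nonneg _)]; exact hpt G)
  refine ⟨i3, (integral_mono i3 i2 hpt).trans (le_of_eq ?_)⟩
  rw [integral_add (((integrable_finsetSum _ fun i _ => i1 i).div_const _).div_const _)
    (integrable_const _), integral_div, integral_div, integral_finsetSum _ fun i _ => i1 i]
  simp only [e1, Finset.sum_const, Finset.card_univ, Fintype.card_fin, nsmul_eq_mul,
    integral_const, probReal_univ, smul_eq_mul, one_mul]
  have : (m:ℝ) = √m * √m := (Real.mul_self_sqrt hm0.le).symm
  have h3 : √m ≠ 0 := by positivity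
  field_simp
  rw [Real.sq_sqrt hm0.le]
  ring

lemma hasDerivAt_erf (x : ℝ) : HasDerivAt erf (2 / √π * rexp (-x ^ 2)) x := by
  have hc : Continuous fun t : ℝ => rexp (-t ^ 2) := by fun_prop
  exact (intervalIntegral.integral_hasDerivAt_right (hc.intervalIntegrable _ _)
    hc.stronglyMeasurable.stronglyMeasurableAtFilter hc.continuousAt).const_mul (2 / √π)

lemma erf_neg (x : ℝ) : erf (-x) = -erf x := by
  unfold erf
  have h := intervalIntegral.integral_comp_neg (fun t : ℝ => rexp (-t ^ 2)) (a := 0) (b := x)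
  simp only [neg_sq, neg_zero] at h
  rw [intervalIntegral.integral_symm, ← h]
  ring

lemma tendsto_erf_atTop : Tendsto erf atTop (nhds 1) := by
  have hi : Integrable fun t : ℝ => rexp (-t ^ 2) := by
    simpa using integrable_exp_neg_mul_sq one_pos
  have h := (intervalIntegral_tendsto_integral_Ioi 0 hi.integrableOn tendsto_id).const_mul (2 / √π)
  have e := integral_gaussian_Ioi 1
  simp only [neg_mul, one_mul, div_one] at e
  rw [e, show 2 / √π * (√π / 2) = 1 by field_simp] at h
  exact h

lemma tendsto_erf_atBot : Tendsto erf atBot (nhds (-1)) := by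
  have h := (tendsto_erf_atTop.comp tendsto_neg_atBot_atTop).neg
  refine h.congr fun x => ?_
  simp [erf_neg]

lemma hasDerivAt_half_erf (x : ℝ) :
    HasDerivAt (fun x => 1 / 2 * erf (x / √2)) (gaussianPDFReal 0 1 x) x := by
  have h := ((hasDerivAt_erf (x / √2)).comp x ((hasDerivAt_id x).div_const √2)).const_mul (1 / 2)
  refine h.congr_deriv ?_
  rw [gaussianPDFReal_zero_one, Real.sqrt_mul (by norm_num), div_pow,
    Real.sq_sqrt (by norm_num), neg_div]
  field_simp

lemma tendsto_half_erf_atTop :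
    Tendsto (fun x => 1 / 2 * erf (x / √2)) atTop (nhds (1 / 2)) := by
  simpa only [mul_one, Function.comp_apply, id] using (tendsto_erf_atTop.comp
    (tendsto_id.atTop_div_const (by positivity : 0 < √2))).const_mul (1 / 2)

lemma tendsto_half_erf_atBot :
    Tendsto (fun x => 1 / 2 * erf (x / √2)) atBot (nhds (-(1 / 2))) := by
  simpa only [mul_neg, mul_one, Function.comp_apply, id] using (tendsto_erf_atBot.comp
    (tendsto_id.atBot_div_const (by positivity : 0 < √2))).const_mul (1 / 2)

lemma tendsto_gaussianPDFReal_atTop : Tendsto (gaussianPDFReal 0 1) atTop (nhds 0) := by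
  have h : Tendsto (fun x : ℝ => -x ^ 2 / 2) atTop atBot :=
    (tendsto_neg_atTop_atBot.comp (tendsto_pow_atTop two_ne_zero)).atBot_div_const (by norm_num)
  have := (tendsto_exp_atBot.comp h).const_mul (√(2 * π))⁻¹
  rw [mul_zero] at this
  exact this.congr fun x => (gaussianPDFReal_zero_one x).symm

lemma tendsto_gaussianPDFReal_atBot : Tendsto (gaussianPDFReal 0 1) atBot (nhds 0) :=
  (tendsto_gaussianPDFReal_atTop.comp tendsto_neg_atBot_atTop).congr fun x => by
    simp [gaussianPDFReal_zero_one]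

/-- The support function `max_{|z| ≤ 1} ((h - ν) z - γ z²)`. -/
noncomputable def boxSupport (γ ν h : ℝ) : ℝ :=
  if |h - ν| ≤ 2 * γ then (h - ν) ^ 2 / (4 * γ) else |h - ν| - γ

lemma le_boxSupport {γ : ℝ} (hγ : 0 < γ) (ν h : ℝ) {z : ℝ} (hz : |z| ≤ 1) :
    (h - ν) * z - γ * z ^ 2 ≤ boxSupport γ ν h := by
  unfold boxSupport
  split_ifs with H
  · rw [le_div_iff₀ (by positivity)]
    nlinarith [sq_nonneg ((h - ν) - 2 * γ * z)]
  · push Not at H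
    have h1 : (h - ν) * z ≤ |h - ν| * |z| := by rw [← abs_mul]; exact le_abs_self _
    have h0 := abs_nonneg z
    rw [← sq_abs z]
    nlinarith [mul_nonneg (sub_nonneg.mpr hz)
      (by nlinarith : 0 ≤ |h - ν| - γ * (1 + |z|))]

lemma abs_boxSupport_le {γ : ℝ} (hγ : 0 < γ) (ν h : ℝ) : |boxSupport γ ν h| ≤ |h - ν| := by
  unfold boxSupport
  have h0 := abs_nonneg (h - ν)
  split_ifs with H
  · rw [abs_of_nonneg (by positivity), div_le_iff₀ (by positivity), ← sq_abs]
    nlinarith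
  · push Not at H
    rw [abs_of_nonneg (by linarith)]
    linarith

lemma boxSupport_of_le {γ ν h : ℝ} (hγ : 0 < γ) (hh : h ≤ ν - 2 * γ) :
    boxSupport γ ν h = ν - γ - h := by
  unfold boxSupport
  have e : |h - ν| = ν - h := by rw [abs_of_nonpos (by linarith)]; ring
  rw [e]
  split_ifs with H
  · rw [show h = ν - 2 * γ by linarith]; field_simp; ring
  · ring

lemma boxSupport_of_ge {γ ν h : ℝ} (hγ : 0 < γ) (hh : ν + 2 * γ ≤ h) :
    boxSupport γ ν h = h - ν - γ := by
  unfold boxSupport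
  have e : |h - ν| = h - ν := abs_of_nonneg (by linarith)
  rw [e]
  split_ifs with H
  · rw [show h = ν + 2 * γ by linarith]; field_simp; ring
  · ring

lemma boxSupport_of_mem {γ ν h : ℝ} (h1 : ν - 2 * γ ≤ h) (h2 : h ≤ ν + 2 * γ) :
    boxSupport γ ν h = (h - ν) ^ 2 / (4 * γ) :=
  if_pos (abs_le.mpr ⟨by linarith, by linarith⟩)

lemma integrable_boxSupport {γ : ℝ} (hγ : 0 < γ) (ν : ℝ) :
    Integrable (boxSupport γ ν) (gaussianReal 0 1) := by
  have hm : Measurable (boxSupport γ ν) := by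
    refine Measurable.ite (measurableSet_le (by fun_prop) (by fun_prop)) (by fun_prop)
      (by fun_prop)
  exact ((integrable_id_gaussianReal_std.sub (integrable_const ν)).abs).mono'
    hm.aestronglyMeasurable (ae_of_all _ fun h => abs_boxSupport_le hγ ν h)

lemma integral_boxSupport {γ : ℝ} (hγ : 0 < γ) (ν : ℝ) :
    ∫ h, boxSupport γ ν h ∂(gaussianReal 0 1) = -(I22 γ ν - I1 γ ν + I21 γ ν) := by
  have hint := (integrable_gaussianReal_zero_one_iff (f := boxSupport γ ν)).mp
    (integrable_boxSupport hγ ν)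
  rw [integral_gaussianReal_zero_one]
  set p := gaussianPDFReal 0 1 with hp
  set a := ν - 2 * γ with ha
  set b := ν + 2 * γ with hb
  have hab : a ≤ b := by linarith
  have dE := hasDerivAt_half_erf
  have dp := hasDerivAt_gaussianPDFReal_zero_one
  have left : ∫ h in Set.Iic a, p h * boxSupport γ ν h =
      (ν - γ) * (1 / 2 * erf (a / √2)) + p a + (ν - γ) * (1 / 2) := by
    have hc : Set.EqOn (fun h => p h * boxSupport γ ν h) (fun h => p h * (ν - γ - h))
        (Set.Iic a) := fun h hh => by
      simp only; rw [boxSupport_of_le hγ hh]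
    rw [setIntegral_congr_fun measurableSet_Iic hc]
    rw [integral_Iic_of_hasDerivAt_of_tendsto' (f := fun x => (ν - γ) * (1 / 2 * erf (x / √2)) + p x)
      (fun x _ => (((dE x).const_mul (ν - γ)).add (dp x)).congr_deriv (by ring))
      ((integrableOn_congr_fun hc measurableSet_Iic).mp hint.integrableOn)
      ((tendsto_half_erf_atBot.const_mul (ν - γ)).add tendsto_gaussianPDFReal_atBot)]
    ring
  have right : ∫ h in Set.Ioi b, p h * boxSupport γ ν h =
      p b - (ν + γ) * (1 / 2) + (ν + γ) * (1 / 2 * erf (b / √2)) := by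
    have hc : Set.EqOn (fun h => p h * boxSupport γ ν h) (fun h => p h * (h - ν - γ))
        (Set.Ioi b) := fun h hh => by
      simp only; rw [boxSupport_of_ge hγ (le_of_lt hh)]
    rw [setIntegral_congr_fun measurableSet_Ioi hc]
    rw [integral_Ioi_of_hasDerivAt_of_tendsto'
      (f := fun x => -(ν + γ) * (1 / 2 * erf (x / √2)) - p x)
      (fun x _ => (((dE x).const_mul (-(ν + γ))).sub (dp x)).congr_deriv (by ring))
      ((integrableOn_congr_fun hc measurableSet_Ioi).mp hint.integrableOn)
      ((tendsto_half_erf_atTop.const_mul (-(ν + γ))).sub tendsto_gaussianPDFReal_atTop)]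
    ring
  have mid : ∫ h in Set.Ioc a b, p h * boxSupport γ ν h =
      ((ν ^ 2 + 1) * (1 / 2 * erf (b / √2)) + (2 * ν - b) * p b -
        ((ν ^ 2 + 1) * (1 / 2 * erf (a / √2)) + (2 * ν - a) * p a)) / (4 * γ) := by
    have hc : Set.EqOn (fun h => p h * boxSupport γ ν h)
        (fun h => p h * ((h - ν) ^ 2 / (4 * γ))) (Set.Ioc a b) := fun h hh => by
      simp only; rw [boxSupport_of_mem hh.1.le hh.2]
    rw [setIntegral_congr_fun measurableSet_Ioc hc, ← intervalIntegral.integral_of_le hab]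
    rw [intervalIntegral.integral_eq_sub_of_hasDerivAt
      (f := fun x => ((ν ^ 2 + 1) * (1 / 2 * erf (x / √2)) + (2 * ν - x) * p x) / (4 * γ))
      (fun x _ => ((((dE x).const_mul (ν ^ 2 + 1)).add
        (((hasDerivAt_id x).const_sub (2 * ν)).mul (dp x))).div_const (4 * γ)).congr_deriv
          (by simp only [id]; ring))
      ((intervalIntegrable_iff_integrableOn_Ioc_of_le hab).mpr
        ((integrableOn_congr_fun hc measurableSet_Ioc).mp hint.integrableOn))]
    ring
  have split : ∫ h, p h * boxSupport γ ν h = (∫ h in Set.Iic a, p h * boxSupport γ ν h) +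
      (∫ h in Set.Ioc a b, p h * boxSupport γ ν h) + ∫ h in Set.Ioi b, p h * boxSupport γ ν h := by
    rw [← setIntegral_union (Set.Iic_disjoint_Ioc le_rfl) measurableSet_Ioc hint.integrableOn
      hint.integrableOn, Set.Iic_union_Ioc_eq_Iic hab, intervalIntegral.integral_Iic_add_Ioi
      hint.integrableOn hint.integrableOn]
  rw [split, left, right, mid]
  have pa : rexp (-(ν - 2 * γ) ^ 2 / 2) = √(2 * π) * p a := by
    rw [hp, gaussianPDFReal_zero_one, ← ha]; field_simp
  have pb : rexp (-(ν + 2 * γ) ^ 2 / 2) = √(2 * π) * p b := by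
    rw [hp, gaussianPDFReal_zero_one, ← hb]; field_simp
  have ea : erf ((2 * γ - ν) / √2) = -erf (a / √2) := by
    rw [← erf_neg, ha]; congr 1; ring
  have hs : √(π / 2) = √(2 * π) / 2 := by
    rw [show π / 2 = (2 * π) / 2 ^ 2 by ring, Real.sqrt_div (by positivity),
      Real.sqrt_sq (by norm_num)]
  unfold I22 I1 I21 erfc
  rw [ea, pa, pb, hs, ← ha, ← hb, show 2 * γ + ν = b by rw [hb]; ring]
  have h2 : √(2 * π) ≠ 0 := by positivity
  have h3 : b = ν + 2 * γ := hb
  have h4 : a = ν - 2 * γ := ha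
  generalize erf (a / √2) = x at *
  generalize erf (b / √2) = y at *
  generalize p a = u at *
  generalize p b = v at *
  rw [h3, h4]
  field_simp
  ring

/-- Gluing an `m × n` Gaussian matrix with a Gaussian column gives an `m × (n + 1)` one. -/
lemma measurePreserving_glue_column (m n : ℕ) :
    MeasurePreserving (fun (p : (Fin m → Fin n → ℝ) × (Fin m → ℝ)) (q : Fin m × Option (Fin n)) =>
        q.2.elim (p.2 q.1) (p.1 q.1))
      ((Measure.pi fun _ => gaussPi (Fin n)).prod (gaussPi (Fin m)))
      (gaussPi (Fin m × Option (Fin n))) := by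
  have hm : Measurable (fun (p : (Fin m → Fin n → ℝ) × (Fin m → ℝ))
      (q : Fin m × Option (Fin n)) => q.2.elim (p.2 q.1) (p.1 q.1)) := by
    refine measurable_pi_iff.mpr ?_
    rintro ⟨i, _ | j⟩
    · simp only [Option.elim_none]; fun_prop
    · simp only [Option.elim_some]; fun_prop
  refine ⟨hm, (Measure.pi_eq fun s hs => ?_).symm⟩
  rw [Measure.map_apply hm (MeasurableSet.univ_pi hs)]
  have e : (fun (p : (Fin m → Fin n → ℝ) × (Fin m → ℝ)) (q : Fin m × Option (Fin n)) =>
      q.2.elim (p.2 q.1) (p.1 q.1)) ⁻¹' Set.univ.pi s =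
      (Set.univ.pi fun i => Set.univ.pi fun j => s (i, some j)) ×ˢ
        (Set.univ.pi fun i => s (i, none)) := by
    ext p
    simp only [Set.mem_preimage, Set.mem_pi, Set.mem_univ, true_imp_iff, Set.mem_prod,
      Prod.forall]
    exact ⟨fun h => ⟨fun i j => h i (some j), fun i => h i none⟩,
      fun h i o => o.casesOn (h.2 i) (h.1 i)⟩
  rw [e, Measure.prod_prod, Measure.pi_pi, Measure.pi_pi]
  simp_rw [Measure.pi_pi, Fintype.prod_prod_type, Fintype.prod_option]
  rw [Finset.prod_mul_distrib, mul_comm]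

lemma sqrt_sum_add_sq_le {I : Type*} [Fintype I] (a b : I → ℝ) :
    √(∑ i, (a i + b i) ^ 2) ≤ √(∑ i, a i ^ 2) + √(∑ i, b i ^ 2) := by
  have h := norm_add_le (WithLp.toLp 2 a : EuclideanSpace ℝ I) (WithLp.toLp 2 b)
  simpa [EuclideanSpace.norm_eq] using h

lemma continuous_sInf_norm_mul {I J : Type*} [Fintype I] [Fintype J] {K : Set (J → ℝ)}
    (hK : IsCompact K) : Continuous fun G : I × J → ℝ =>
      sInf ((fun w : J → ℝ => √(∑ i, (∑ j, w j * G (i, j)) ^ 2)) '' K) := by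
  set F : (I × J → ℝ) → (J → ℝ) → ℝ := fun G w => √(∑ i, (∑ j, w j * G (i, j)) ^ 2) with hF
  have hFc : Continuous (Function.uncurry F) := by
    simp only [hF, Function.uncurry_def]; fun_prop
  exact hK.continuous_sInf hFc

/-- Gordon's comparison for the minimum of `‖G w‖` over a compact subset of a sphere. -/
lemma gordon_compact {J : Type*} [Fintype J] {K : Set (J → ℝ)} (hK : IsCompact K)
    (hne : K.Nonempty) {R : ℝ} (hR : 0 < R) (hw : ∀ w ∈ K, ∑ j, w j ^ 2 = R ^ 2) {m : ℕ}
    (hm : 0 < m) {L : (J → ℝ) → ℝ} (hLi : Integrable L (gaussPi J))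
    (hL : ∀ h, ∀ w ∈ K, L h ≤ ∑ j, w j * h j) :
    R * √m * (1 - Var[fun x : ℝ => x ^ 2; gaussianReal 0 1] / (2 * m)) + ∫ h, L h ∂(gaussPi J) ≤
      ∫ G, sInf ((fun w : J → ℝ => √(∑ i, (∑ j, w j * G (i, j)) ^ 2)) '' K)
        ∂(gaussPi (Fin m × J)) ∧
    ∫ G, sInf ((fun w : J → ℝ => √(∑ i, (∑ j, w j * G (i, j)) ^ 2)) '' K)
        ∂(gaussPi (Fin m × J)) ≤ √m * R := by
  classical
  set F : (Fin m × J → ℝ) → (J → ℝ) → ℝ := fun G w => √(∑ i, (∑ j, w j * G (i, j)) ^ 2) with hF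
  have hFG : ∀ G, Continuous (F G) := fun G => by simp only [hF]; fun_prop
  have hbdd : ∀ G, BddBelow (F G '' K) := fun G => ⟨0, by
    rintro _ ⟨w, -, rfl⟩; exact Real.sqrt_nonneg _⟩
  have hcont : Continuous fun G => sInf (F G '' K) :=
    continuous_sInf_norm_mul hK
  obtain ⟨w₀, hw₀⟩ := hne
  obtain ⟨hi₀, hle₀⟩ := integral_norm_matrix_mul_le m hR hm (hw w₀ hw₀)
  have hle : ∀ G, sInf (F G '' K) ≤ F G w₀ := fun G => csInf_le (hbdd G) ⟨w₀, hw₀, rfl⟩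
  have hnn : ∀ G, 0 ≤ sInf (F G '' K) := fun G => Real.sInf_nonneg (by
    rintro _ ⟨w, -, rfl⟩; exact Real.sqrt_nonneg _)
  have hint : Integrable (fun G => sInf (F G '' K)) (gaussPi (Fin m × J)) :=
    hi₀.mono' hcont.aestronglyMeasurable (ae_of_all _ fun G => by
      rw [Real.norm_of_nonneg (hnn G)]; exact hle G)
  refine ⟨?_, (integral_mono hint hi₀ hle).trans hle₀⟩
  have hN : Integrable (fun G : Fin m × J → ℝ => ∑ i, ∑ j, |G (i, j)|) (gaussPi (Fin m × J)) :=
    integrable_finsetSum _ fun i _ => integrable_finsetSum _ fun j _ =>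
      (integrable_eval_gaussPi (i, j)).abs
  set C := ∫ G, ∑ i, ∑ j, |G (i, j)| ∂(gaussPi (Fin m × J)) with hC
  have hC0 : 0 ≤ C := integral_nonneg fun G => by positivity
  refine le_of_forall_pos_le_add fun δ hδ => ?_
  set ε := δ / (C + 1) with hε
  have hε0 : 0 < ε := by positivity
  obtain ⟨t, htK, htf, hcov⟩ := hK.finite_cover_balls hε0
  have : Finite t := htf
  have : Nonempty t := by
    obtain ⟨x, hx, -⟩ := Set.mem_iUnion₂.mp (hcov hw₀)
    exact ⟨⟨x, hx⟩⟩
  have key := gordon_finite (I := Fin m) (T := t) (R := R) (w := fun x => x.1)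
    (fun x => hw _ (htK x.2)) hLi (hint.add (hN.const_mul ε)) (fun h x => hL h _ (htK x.2))
    (fun G => by
      obtain ⟨w, hwK, hwe⟩ := hK.exists_sInf_image_eq ⟨w₀, hw₀⟩ (hFG G).continuousOn
      obtain ⟨x, hx, hd⟩ := Set.mem_iUnion₂.mp (hcov hwK)
      refine ⟨⟨x, hx⟩, ?_⟩
      have h1 := sqrt_sum_add_sq_le (fun i => ∑ j, w j * G (i, j))
        (fun i => ∑ j, (x j - w j) * G (i, j))
      have h2 : √(∑ i, (∑ j, (x j - w j) * G (i, j)) ^ 2) ≤ ε * ∑ i, ∑ j, |G (i, j)| := by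
        refine (sqrt_sum_sq_le_sum_abs _).trans ?_
        rw [Finset.mul_sum]
        refine Finset.sum_le_sum fun i _ => (Finset.abs_sum_le_sum_abs _ _).trans ?_
        rw [Finset.mul_sum]
        refine Finset.sum_le_sum fun j _ => ?_
        rw [abs_mul]
        refine mul_le_mul_of_nonneg_right ?_ (abs_nonneg _)
        have h3 := dist_le_pi_dist x w j
        rw [Real.dist_eq, dist_comm] at h3
        exact h3.trans (Metric.mem_ball.mp hd).le
      have h4 : ∀ i, ∑ j, w j * G (i, j) + ∑ j, (x j - w j) * G (i, j) = ∑ j, x j * G (i, j) :=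
        fun i => by rw [← Finset.sum_add_distrib]; exact Finset.sum_congr rfl fun j _ => by ring
      simp only [h4] at h1
      simp only [Pi.add_apply]
      rw [hwe]
      exact h1.trans (add_le_add le_rfl h2))
  have hU := integral_add hint (hN.const_mul ε)
  rw [integral_const_mul, ← hC] at hU
  simp only [Pi.add_apply] at key
  rw [hU] at key
  have hCε : ε * C ≤ δ := by
    rw [hε, div_mul_eq_mul_div, div_le_iff₀ (by positivity)]
    nlinarith
  have hg := sqrt_sub_le_integral_norm_gaussPi m hm hR.le
  linarith

/-- Lower and upper bounds at fixed dimension for the expected primal optimum. -/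
lemma integral_sInf_clup_bounds {σ c1 c2 R : ℝ} (hR : 0 < R)
    (hR2 : R ^ 2 = 1 - 2 * c1 + c2 + σ ^ 2) {m n : ℕ} (hm : 0 < m) (hn : 0 < n)
    {S : Set (Fin n → ℝ)}
    (hS : S = {x | (∀ i, x i ∈ Set.Icc (-(1 / √n)) (1 / √n)) ∧
      (∑ i, (1 / √n) * x i) = c1 ∧ (∑ i, (x i) ^ 2) = c2}) (hne : S.Nonempty)
    {γ : ℝ} (hγ : 0 < γ) (ν : ℝ) :
    R * √m * (1 - Var[fun x : ℝ => x ^ 2; gaussianReal 0 1] / (2 * m)) +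
        √n * (I22 γ ν - I1 γ ν + I21 γ ν - ν * c1 - γ * c2) ≤
      (∫ p : (Fin m → Fin n → ℝ) × (Fin m → ℝ),
        sInf ((fun x : Fin n → ℝ =>
          √(∑ i, (∑ j, p.1 i j * (1 / √n - x j) + σ * p.2 i) ^ 2)) '' S)
        ∂((Measure.pi fun _ => gaussPi (Fin n)).prod (gaussPi (Fin m)))) ∧
    (∫ p : (Fin m → Fin n → ℝ) × (Fin m → ℝ),
        sInf ((fun x : Fin n → ℝ =>
          √(∑ i, (∑ j, p.1 i j * (1 / √n - x j) + σ * p.2 i) ^ 2)) '' S)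
        ∂((Measure.pi fun _ => gaussPi (Fin n)).prod (gaussPi (Fin m)))) ≤ √m * R := by
  have hn0 : (0:ℝ) < n := by exact_mod_cast hn
  set s := √(n:ℝ) with hs
  have hs0 : 0 < s := Real.sqrt_pos.mpr hn0
  have hss : s ^ 2 = n := Real.sq_sqrt hn0.le
  set w : (Fin n → ℝ) → Option (Fin n) → ℝ := fun x o => o.elim σ fun j => 1 / s - x j with hw
  have hwc : Continuous w := by
    refine continuous_pi fun o => ?_
    cases o
    · simp only [hw, Option.elim_none]; fun_prop
    · simp only [hw, Option.elim_some]; fun_prop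
  have hSc : IsCompact S := by
    have e : S = Set.Icc (fun _ => -(1 / s)) (fun _ => 1 / s) ∩
        {x | (∑ i, (1 / s) * x i) = c1 ∧ (∑ i, (x i) ^ 2) = c2} := by
      rw [hS]
      ext x
      simp only [Set.mem_ofPred_eq, Set.mem_inter_iff, Set.mem_Icc, Pi.le_def, forall_and]
    rw [e]
    exact isCompact_Icc.inter_right ((isClosed_eq (by fun_prop) (by fun_prop)).inter
      (isClosed_eq (by fun_prop) (by fun_prop)))
  have hsum : ∀ x ∈ S, ∑ i, x i = s * c1 := fun x hx => by
    rw [hS] at hx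
    rw [← hx.2.1, ← Finset.mul_sum]
    field_simp
  have hwR : ∀ u ∈ w '' S, ∑ o, u o ^ 2 = R ^ 2 := by
    rintro _ ⟨x, hx, rfl⟩
    have h1 := hsum x hx
    rw [hS] at hx
    have e : ∀ j, (1 / s - x j) ^ 2 = 1 / s ^ 2 - 2 / s * x j + x j ^ 2 := fun j => by
      field_simp; ring
    simp only [hw, Fintype.sum_option, Option.elim_none, Option.elim_some, e,
      Finset.sum_add_distrib, Finset.sum_sub_distrib, ← Finset.mul_sum, h1, hx.2.2, hR2]
    simp only [Finset.sum_const, Finset.card_univ, Fintype.card_fin, nsmul_eq_mul, hss]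
    field_simp
    ring
  set L : (Option (Fin n) → ℝ) → ℝ := fun h => ∑ j, (1 / s) * h (some j) + σ * h none -
    (1 / s) * ∑ j, boxSupport γ ν (h (some j)) - s * (ν * c1 + γ * c2) with hLdef
  have hk := integrable_boxSupport hγ ν
  have i1 : Integrable (fun h : Option (Fin n) → ℝ => ∑ j, (1 / s) * h (some j)) (gaussPi _) :=
    integrable_finsetSum _ fun j _ => (integrable_eval_gaussPi (some j)).const_mul _
  have i2 : Integrable (fun h : Option (Fin n) → ℝ => σ * h none) (gaussPi _) :=
    (integrable_eval_gaussPi none).const_mul _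
  have i3 : Integrable (fun h : Option (Fin n) → ℝ =>
      (1 / s) * ∑ j, boxSupport γ ν (h (some j))) (gaussPi _) :=
    (integrable_finsetSum _ fun j _ => integrable_comp_eval_gaussPi (some j) hk).const_mul _
  have hLi : Integrable L (gaussPi _) := ((i1.add i2).sub i3).sub (integrable_const _)
  have hLint : ∫ h, L h ∂(gaussPi (Option (Fin n))) =
      s * (I22 γ ν - I1 γ ν + I21 γ ν - ν * c1 - γ * c2) := by
    have e1 : ∫ h : Option (Fin n) → ℝ, ∑ j, (1 / s) * h (some j) ∂(gaussPi _) = 0 := by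
      rw [integral_finsetSum _ fun j _ => (integrable_eval_gaussPi (some j)).const_mul _]
      simp [integral_const_mul, integral_eval_gaussPi]
    have e2 : ∫ h : Option (Fin n) → ℝ, σ * h none ∂(gaussPi _) = 0 := by
      rw [integral_const_mul, integral_eval_gaussPi, mul_zero]
    have e3 : ∫ h : Option (Fin n) → ℝ, (1 / s) * ∑ j, boxSupport γ ν (h (some j)) ∂(gaussPi _) =
        -s * (I22 γ ν - I1 γ ν + I21 γ ν) := by
      rw [integral_const_mul,
        integral_finsetSum _ fun j _ => integrable_comp_eval_gaussPi (some j) hk]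
      simp only [integral_comp_eval_gaussPi _ hk, integral_boxSupport hγ, Finset.sum_const,
        Finset.card_univ, Fintype.card_fin, nsmul_eq_mul, ← hss]
      field_simp
    have i4 : Integrable (fun h : Option (Fin n) → ℝ => ∑ j, (1 / s) * h (some j) + σ * h none -
        (1 / s) * ∑ j, boxSupport γ ν (h (some j))) (gaussPi _) := (i1.add i2).sub i3
    rw [hLdef, integral_sub i4 (integrable_const _),
      integral_sub (i1.fun_add i2) i3, integral_add i1 i2, e1, e2, e3, integral_const,
      probReal_univ, one_smul]
    ring
  have hL : ∀ h, ∀ u ∈ w '' S, L h ≤ ∑ o, u o * h o := by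
    rintro h _ ⟨x, hx, rfl⟩
    have h1 := hsum x hx
    rw [hS] at hx
    have hx2 : ∑ j, x j ^ 2 = c2 := hx.2.2
    have hpt : ∀ j, x j * h (some j) ≤
        (1 / s) * boxSupport γ ν (h (some j)) + ν * x j + γ * s * x j ^ 2 := fun j => by
      have hz : |s * x j| ≤ 1 := by
        rw [abs_mul, abs_of_pos hs0]
        have := abs_le.mpr (hx.1 j)
        rwa [le_div_iff₀' hs0] at this
      have hb := mul_le_mul_of_nonneg_left (le_boxSupport hγ ν (h (some j)) hz)
        (by positivity : 0 ≤ 1 / s)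
      have e : 1 / s * ((h (some j) - ν) * (s * x j) - γ * (s * x j) ^ 2) =
        x j * h (some j) - ν * x j - γ * s * x j ^ 2 := by field_simp
      linarith
    have hsm := Finset.sum_le_sum fun j (_ : j ∈ Finset.univ) => hpt j
    simp only [Finset.sum_add_distrib, ← Finset.mul_sum, h1, hx2] at hsm
    simp only [hLdef, hw, Fintype.sum_option, Option.elim_none, Option.elim_some, sub_mul,
      Finset.sum_sub_distrib]
    linarith
  have key := gordon_compact (hSc.image hwc) (hne.image w) hR hwR hm hLi hL
  rw [hLint] at key
  have hint : ∫ G, sInf ((fun u : Option (Fin n) → ℝ => √(∑ i, (∑ j, u j * G (i, j)) ^ 2)) ''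
      (w '' S)) ∂(gaussPi (Fin m × Option (Fin n))) =
      ∫ p : (Fin m → Fin n → ℝ) × (Fin m → ℝ),
        sInf ((fun x : Fin n → ℝ =>
          √(∑ i, (∑ j, p.1 i j * (1 / s - x j) + σ * p.2 i) ^ 2)) '' S)
        ∂((Measure.pi fun _ => gaussPi (Fin n)).prod (gaussPi (Fin m))) := by
    have hmp := measurePreserving_glue_column m n
    have hc := continuous_sInf_norm_mul (I := Fin m) (hSc.image hwc)
    rw [← hmp.map_eq, integral_map hmp.measurable.aemeasurable hc.aestronglyMeasurable]
    refine integral_congr_ae (ae_of_all _ fun p => ?_)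
    simp only [Set.image_image, hw, Fintype.sum_option, Option.elim_none, Option.elim_some]
    refine congrArg sInf (Set.image_congr fun x _ => ?_)
    refine congrArg Real.sqrt (Finset.sum_congr rfl fun i _ => ?_)
    rw [add_comm]
    simp only [mul_comm]
  rwa [hint] at key

/-- the liminf of the (normalized, expected) constrained primal optimum is
lower bounded by the supremum over `γ > 0, ν ∈ ℝ` of the random dual `ξ_RD`. -/
theorem clup_rdt_lower_bound
    (α σ c2 c1 : ℝ) (hα : 0 < α) (hσ : 0 < σ)
    (hc2 : 0 < c2) (hc2' : c2 ≤ 1) (hc1 : 0 ≤ c1) (hc1' : c1 ≤ Real.sqrt c2)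
    (S : (n : ℕ) → Set (Fin n → ℝ))
    (hS : ∀ n, S n =
      {x | (∀ i, x i ∈ Set.Icc (-(1 / Real.sqrt n)) (1 / Real.sqrt n)) ∧
           (∑ i, (1 / Real.sqrt n) * x i) = c1 ∧ (∑ i, (x i)^2) = c2})
    (hne : ∀ᶠ n in atTop, (S n).Nonempty)
    (ξ : ℕ → ℝ)
    (hξ : ∀ n : ℕ, ξ n = (1 / Real.sqrt n) *
      ∫ p : (Fin (Nat.ceil (α * n)) → Fin n → ℝ) × (Fin (Nat.ceil (α * n)) → ℝ),
        sInf ((fun x : Fin n → ℝ =>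
          Real.sqrt (∑ i, (∑ j, p.1 i j * (1 / Real.sqrt n - x j) + σ * p.2 i)^2)) '' S n)
        ∂((Measure.pi fun _ => Measure.pi fun _ => gaussianReal 0 1).prod
            (Measure.pi fun _ => gaussianReal 0 1))) :
    (⨆ γ : {g : ℝ // 0 < g}, ⨆ ν : ℝ, xiRD α σ c2 c1 γ.1 ν) ≤ atTop.liminf ξ := by
  set R := √(1 - 2 * c1 + c2 + σ ^ 2) with hRdef
  have hpos : 0 < 1 - 2 * c1 + c2 + σ ^ 2 := by
    have h := Real.sq_sqrt hc2.le
    nlinarith [sq_nonneg (√c2 - 1), sq_pos_of_pos hσ]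
  have hR : 0 < R := Real.sqrt_pos.mpr hpos
  have hR2 : R ^ 2 = 1 - 2 * c1 + c2 + σ ^ 2 := Real.sq_sqrt hpos.le
  set V := Var[fun x : ℝ => x ^ 2; gaussianReal 0 1]
  have hV : 0 ≤ V := variance_nonneg _ _
  have hbounds : ∀ γ : ℝ, 0 < γ → ∀ ν : ℝ, ∀ᶠ n : ℕ in atTop,
      R * √α * (1 - V / (2 * (α * n))) +
        (I22 γ ν - I1 γ ν + I21 γ ν - ν * c1 - γ * c2) ≤ ξ n ∧ ξ n ≤ √(α + 1) * R := by
    intro γ hγ ν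
    have hlarge : ∀ᶠ n : ℕ in atTop, V / (2 * α) ≤ n :=
      tendsto_natCast_atTop_atTop.eventually_ge_atTop _
    filter_upwards [hne, eventually_ge_atTop 1, hlarge] with n hnne hn1 hVn
    have hn0 : (0:ℝ) < n := by exact_mod_cast hn1
    have hm : 0 < ⌈α * n⌉₊ := Nat.ceil_pos.mpr (by positivity)
    have hm0 : (0:ℝ) < (⌈α * n⌉₊ : ℝ) := by exact_mod_cast hm
    have hmle : α * n ≤ (⌈α * n⌉₊ : ℝ) := Nat.le_ceil _
    have hmge : (⌈α * n⌉₊ : ℝ) ≤ (α + 1) * n := by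
      have := (Nat.ceil_lt_add_one (by positivity : 0 ≤ α * n)).le
      have h1 : (1:ℝ) ≤ n := by exact_mod_cast hn1
      linarith
    obtain ⟨hlo, hup⟩ := integral_sInf_clup_bounds hR hR2 hm hn1 (hS n) hnne hγ ν
    rw [hξ n]
    set I := ∫ p : (Fin (Nat.ceil (α * n)) → Fin n → ℝ) × (Fin (Nat.ceil (α * n)) → ℝ),
        sInf ((fun x : Fin n → ℝ =>
          Real.sqrt (∑ i, (∑ j, p.1 i j * (1 / Real.sqrt n - x j) + σ * p.2 i)^2)) '' S n)
        ∂((Measure.pi fun _ => Measure.pi fun _ => gaussianReal 0 1).prod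
            (Measure.pi fun _ => gaussianReal 0 1))
    generalize (⌈α * n⌉₊ : ℝ) = M at *
    have hs0 : 0 < √(n:ℝ) := Real.sqrt_pos.mpr hn0
    have hsM : √α * √n ≤ √M := by
      rw [← Real.sqrt_mul hα.le]; exact Real.sqrt_le_sqrt hmle
    have hsM' : √M ≤ √(α + 1) * √n := by
      rw [← Real.sqrt_mul (by positivity)]; exact Real.sqrt_le_sqrt hmge
    constructor
    · rw [one_div, inv_mul_eq_div, le_div_iff₀ hs0]
      refine le_trans ?_ hlo
      have h1 : 0 ≤ 1 - V / (2 * (α * n)) := by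
        rw [sub_nonneg, div_le_one (by positivity)]
        rw [div_le_iff₀ (by positivity)] at hVn
        linarith
      have h2 : 1 - V / (2 * (α * n)) ≤ 1 - V / (2 * M) := by gcongr
      have h3 : R * (√α * √n) * (1 - V / (2 * (α * n))) ≤ R * √M * (1 - V / (2 * M)) := by
        gcongr
      linarith
    · rw [one_div, inv_mul_eq_div, div_le_iff₀ hs0]
      nlinarith
  have hcob : IsCoboundedUnder (· ≥ ·) atTop ξ :=
    (isBoundedUnder_of_eventually_le ((hbounds 1 one_pos 0).mono fun _ h => h.2)).isCoboundedUnder_ge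
  have : Nonempty {g : ℝ // 0 < g} := ⟨⟨1, one_pos⟩⟩
  refine ciSup_le fun γ => ciSup_le fun ν => ?_
  have hlim : Tendsto (fun n : ℕ => R * √α * (1 - V / (2 * (α * n))) +
      (I22 γ.1 ν - I1 γ.1 ν + I21 γ.1 ν - ν * c1 - γ.1 * c2)) atTop
      (nhds (xiRD α σ c2 c1 γ.1 ν)) := by
    have h0 : Tendsto (fun n : ℕ => V / (2 * (α * n))) atTop (nhds 0) :=
      Tendsto.const_div_atTop ((tendsto_natCast_atTop_atTop.const_mul_atTop hα).const_mul_atTop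
        two_pos) V
    have h1 := ((h0.const_sub 1).const_mul (R * √α)).add_const
      (I22 γ.1 ν - I1 γ.1 ν + I21 γ.1 ν - ν * c1 - γ.1 * c2)
    convert h1 using 2
    unfold xiRD
    rw [← hRdef]
    ring
  rw [← hlim.liminf_eq]
  exact liminf_le_liminf ((hbounds γ.1 γ.2 ν).mono fun _ h => h.1) hlim.isBoundedUnder_ge hcob
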